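/- arXiv:1910.10889 — 2 statements merged into one kernel-verified Lean document; each statement's English description precedes it below -/
import Mathlib

section
/- The verification problem for coherent programs modulo EPR axioms is undecidable: there is no algorithm that, given a finite first-order signature Σ, a finite set A of EPR sentences over Σ, a finite variable set V, a program s over (Σ, V) that is coherent modulo A, and a quantifier-free postcondition φ, decides whether s satisfies φ modulo A. -/
namespace PVMA

open FirstOrder FirstOrder.Language


/-! ### Executions -/

/-- The alphabet Π of program letters. -/
inductive ProgLetter (L : FirstOrder.Language.{0,0}) (V : Type) : Type where
  | assign (x y : V)
  | call (x : V) {n : ℕ} (f : L.Functions n) (z : Fin n → V)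
  | assumeEq (x y : V)
  | assumeNe (x y : V)
  | assumeRel {n : ℕ} (r : L.Relations n) (z : Fin n → V)
  | assumeNRel {n : ℕ} (r : L.Relations n) (z : Fin n → V)

/-- Executions are finite words over Π. -/
abbrev Exec (L : FirstOrder.Language.{0,0}) (V : Type) := List (ProgLetter L V)

variable {L : FirstOrder.Language.{0,0}} {V : Type}

section TEval

variable [DecidableEq V]

/-- One step of the symbolic state transformer. -/
def stepState (st : V → L.Term Empty) : ProgLetter L V → (V → L.Term Empty)
  | .assign x y => Function.update st x (st y)
  | .call x f z => Function.update st x (Term.func f fun i => st (z i))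
  | _ => st

/-- `TEval init ρ x` is the ground term stored in variable `x` after execution `ρ`. -/
def TEval (init : V → L.Constants) (ρ : Exec L V) : V → L.Term Empty :=
  ρ.foldl stepState (fun x => Constants.term (init x))

/-- The set of terms computed by an execution. -/
def TermsOf (init : V → L.Constants) (ρ : Exec L V) : Set (L.Term Empty) :=
  { t | ∃ σ x, σ <+: ρ ∧ TEval init σ x = t }

end TEval

/-- Ground literals over the signature. -/
inductive GLit (L : FirstOrder.Language.{0,0}) : Type where
  | eq (t₁ t₂ : L.Term Empty)
  | ne (t₁ t₂ : L.Term Empty)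
  | rel {n : ℕ} (r : L.Relations n) (ts : Fin n → L.Term Empty)
  | nrel {n : ℕ} (r : L.Relations n) (ts : Fin n → L.Term Empty)

/-- The ground literal contributed by an assume letter, given the current symbolic state. -/
def litOf (st : V → L.Term Empty) : ProgLetter L V → Option (GLit L)
  | .assumeEq x y => some (.eq (st x) (st y))
  | .assumeNe x y => some (.ne (st x) (st y))
  | .assumeRel r z => some (.rel r fun i => st (z i))
  | .assumeNRel r z => some (.nrel r fun i => st (z i))
  | _ => none

/-- κ(ρ): the set of ground literals accumulated by the execution ρ. -/
def kappa [DecidableEq V] (init : V → L.Constants) (ρ : Exec L V) : Set (GLit L) :=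
  { l | ∃ σ a, (σ ++ [a]) <+: ρ ∧ litOf (TEval init σ) a = some l }

/-! ### Structures -/

/-- A bundled (nonempty) first-order structure for the language `L`. -/
structure Struc (L : FirstOrder.Language.{0,0}) where
  carrier : Type
  inst : L.Structure carrier
  nonempty : Nonempty carrier

/-- Evaluation of a ground term in a structure. -/
def Struc.evalT (M : Struc L) (t : L.Term Empty) : M.carrier :=
  @Term.realize L M.carrier M.inst Empty Empty.elim t

/-- Satisfaction of a ground literal. -/
def Struc.SatLit (M : Struc L) : GLit L → Prop
  | .eq t₁ t₂ => M.evalT t₁ = M.evalT t₂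
  | .ne t₁ t₂ => M.evalT t₁ ≠ M.evalT t₂
  | .rel r ts => @Structure.RelMap L M.carrier M.inst _ r (fun i => M.evalT (ts i))
  | .nrel r ts => ¬ @Structure.RelMap L M.carrier M.inst _ r (fun i => M.evalT (ts i))

/-- Satisfaction of a sentence. -/
def Struc.Sat (M : Struc L) (φ : L.Sentence) : Prop :=
  @Sentence.Realize L M.carrier M.inst φ

/-- Satisfaction of a theory. -/
def Struc.SatTheory (M : Struc L) (A : L.Theory) : Prop := ∀ φ ∈ A, M.Sat φ

variable [DecidableEq V]

/-- Feasibility of an execution in a structure. -/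
def FeasibleIn (M : Struc L) (init : V → L.Constants) (ρ : Exec L V) : Prop :=
  ∀ σ a, (σ ++ [a]) <+: ρ → ∀ l, litOf (TEval init σ) a = some l → M.SatLit l

/-- Feasibility modulo a set of axioms. -/
def FeasibleModulo (A : L.Theory) (init : V → L.Constants) (ρ : Exec L V) : Prop :=
  ∃ M : Struc L, M.SatTheory A ∧ FeasibleIn M init ρ

/-- `EntailsEq A K t₁ t₂` : the axioms `A` together with the ground literals `K`
entail the equality `t₁ = t₂` (written `t₁ ≅_{A ∪ K} t₂`). -/
def EntailsEq (A : L.Theory) (K : Set (GLit L)) (t₁ t₂ : L.Term Empty) : Prop :=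
  ∀ M : Struc L, M.SatTheory A → (∀ l ∈ K, M.SatLit l) → M.evalT t₁ = M.evalT t₂

/-! ### Coherence -/

/-- Whether a letter is an assume statement. -/
def IsAssume : ProgLetter L V → Prop
  | .assumeEq _ _ => True
  | .assumeNe _ _ => True
  | .assumeRel _ _ => True
  | .assumeNRel _ _ => True
  | _ => False

/-- The memoizing property modulo axioms `A`. -/
def Memoizing (A : L.Theory) (init : V → L.Constants) (ρ : Exec L V) : Prop :=
  ∀ (σ : Exec L V) (x : V) {n : ℕ} (f : L.Functions n) (z : Fin n → V),
    (σ ++ [ProgLetter.call x f z]) <+: ρ →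
    (∃ t' ∈ TermsOf init σ,
        EntailsEq A (kappa init σ) t' (Term.func f fun i => TEval init σ (z i))) →
    ∃ y : V, EntailsEq A (kappa init σ) (TEval init σ y) (Term.func f fun i => TEval init σ (z i))

/-- The early-assumes property modulo axioms `A`. -/
def EarlyAssumes (A : L.Theory) (init : V → L.Constants) (ρ : Exec L V) : Prop :=
  ∀ (σ : Exec L V) (a : ProgLetter L V), (σ ++ [a]) <+: ρ → IsAssume a →
    ∀ t ∈ TermsOf init σ,
      (∀ x : V, ¬ EntailsEq A (kappa init σ) (TEval init σ x) t) →
      ∀ t' ∈ TermsOf init σ,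
        EntailsEq A (kappa init (σ ++ [a])) t t' → EntailsEq A (kappa init σ) t t'

/-- Coherence of an execution modulo axioms `A`. -/
def Coherent (A : L.Theory) (init : V → L.Constants) (ρ : Exec L V) : Prop :=
  Memoizing A init ρ ∧ EarlyAssumes A init ρ

end PVMA
namespace PVMA

open FirstOrder FirstOrder.Language


variable {L : FirstOrder.Language.{0,0}} {V : Type}

/-! ### Axiom sentences -/

/-- φ_refl^R = ∀x. R(x,x) -/
def phiRefl (r : L.Relations 2) : L.Sentence := ∀' r.boundedFormula₂ (&0) &0

/-- φ_irref^R = ∀x. ¬R(x,x) -/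
def phiIrref (r : L.Relations 2) : L.Sentence := ∀' ∼(r.boundedFormula₂ (&0) &0)

/-- φ_symm^R = ∀x y. R(x,y) → R(y,x) -/
def phiSymm (r : L.Relations 2) : L.Sentence :=
  ∀' ∀' (r.boundedFormula₂ (&0) &1 ⟹ r.boundedFormula₂ (&1) &0)

/-- φ_trans^R = ∀x y z. R(x,y) ∧ R(y,z) → R(x,z) -/
def phiTrans (r : L.Relations 2) : L.Sentence :=
  ∀' ∀' ∀' ((r.boundedFormula₂ (&0) &1 ⊓ r.boundedFormula₂ (&1) &2) ⟹ r.boundedFormula₂ (&0) &2)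

/-- ∀ x y. x = y ∨ R(x,y) ∨ R(y,x) (totality) -/
def phiTotal (r : L.Relations 2) : L.Sentence :=
  ∀' ∀' (Term.bdEqual (&0) (&1) ⊔ r.boundedFormula₂ (&0) &1 ⊔ r.boundedFormula₂ (&1) &0)

/-- A_STO^R = {φ_irref^R, φ_trans^R, totality} -/
def ASTO (r : L.Relations 2) : L.Theory := {phiIrref r, phiTrans r, phiTotal r}

/-- A_SPO^R = {φ_irref^R, φ_trans^R} -/
def ASPO (r : L.Relations 2) : L.Theory := {phiIrref r, phiTrans r}

/-- φ_comm^f = ∀x y. f(x,y) = f(y,x) -/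
def phiComm (f : L.Functions 2) : L.Sentence :=
  ∀' ∀' Term.bdEqual (Functions.apply₂ f (&0) &1) (Functions.apply₂ f (&1) &0)

/-- φ_idem^f = ∀x. f(f(x)) = f(x) -/
def phiIdem (f : L.Functions 1) : L.Sentence :=
  ∀' Term.bdEqual (Functions.apply₁ f (Functions.apply₁ f &0)) (Functions.apply₁ f &0)

/-- φ_assoc^f = ∀x y z. f(f(x,y),z) = f(x,f(y,z)) -/
def phiAssoc (f : L.Functions 2) : L.Sentence :=
  ∀' ∀' ∀' Term.bdEqual (Functions.apply₂ f (Functions.apply₂ f (&0) &1) &2)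
    (Functions.apply₂ f (&0) (Functions.apply₂ f (&1) &2))

/-! ### Occurrence of symbols in formulas -/

/-- A term mentions a function symbol. -/
def TermMentionsFunc (fs : Σ n, L.Functions n) {α : Type} : L.Term α → Prop
  | .var _ => False
  | .func g ts => (⟨_, g⟩ : Σ n, L.Functions n) = fs ∨ ∃ i, TermMentionsFunc fs (ts i)

/-- A bounded formula mentions a relation symbol. -/
def MentionsRel (R : Σ n, L.Relations n) {α : Type} : ∀ {n : ℕ}, L.BoundedFormula α n → Prop
  | _, .falsum => False
  | _, .equal _ _ => False
  | _, .rel r _ => (⟨_, r⟩ : Σ n, L.Relations n) = R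
  | _, .imp φ ψ => MentionsRel R φ ∨ MentionsRel R ψ
  | _, .all φ => MentionsRel R φ

/-- A bounded formula mentions a function symbol. -/
def MentionsFunc (fs : Σ n, L.Functions n) {α : Type} : ∀ {n : ℕ}, L.BoundedFormula α n → Prop
  | _, .falsum => False
  | _, .equal t₁ t₂ => TermMentionsFunc fs t₁ ∨ TermMentionsFunc fs t₂
  | _, .rel _ ts => ∃ i, TermMentionsFunc fs (ts i)
  | _, .imp φ ψ => MentionsFunc fs φ ∨ MentionsFunc fs ψ
  | _, .all φ => MentionsFunc fs φ

end PVMA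
namespace PVMA

open FirstOrder FirstOrder.Language


variable {L : FirstOrder.Language.{0,0}} {V : Type}

/-! ### Programs -/

/-- Atomic conditions. -/
inductive AtomCond (L : FirstOrder.Language.{0,0}) (V : Type) : Type where
  | eq (x y : V)
  | ne (x y : V)
  | rel {n : ℕ} (r : L.Relations n) (z : Fin n → V)
  | nrel {n : ℕ} (r : L.Relations n) (z : Fin n → V)

/-- The assume letter corresponding to an atomic condition. -/
def AtomCond.toLetter : AtomCond L V → ProgLetter L V
  | .eq x y => .assumeEq x y
  | .ne x y => .assumeNe x y
  | .rel r z => .assumeRel r z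
  | .nrel r z => .assumeNRel r z

/-- The assume letter corresponding to the negation of an atomic condition. -/
def AtomCond.negLetter : AtomCond L V → ProgLetter L V
  | .eq x y => .assumeNe x y
  | .ne x y => .assumeEq x y
  | .rel r z => .assumeNRel r z
  | .nrel r z => .assumeRel r z

/-- Programs. -/
inductive Prog (L : FirstOrder.Language.{0,0}) (V : Type) : Type where
  | skip
  | assign (x y : V)
  | call (x : V) {n : ℕ} (f : L.Functions n) (z : Fin n → V)
  | passume (c : AtomCond L V)
  | seq (s₁ s₂ : Prog L V)
  | ite (c : AtomCond L V) (s₁ s₂ : Prog L V)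
  | while (c : AtomCond L V) (s : Prog L V)

/-- The set of executions of a program. -/
def ExecSet : Prog L V → Set (Exec L V)
  | .skip => {[]}
  | .assign x y => {[.assign x y]}
  | .call x f z => {[.call x f z]}
  | .passume c => {[c.toLetter]}
  | .seq s₁ s₂ => { ρ | ∃ ρ₁ ∈ ExecSet s₁, ∃ ρ₂ ∈ ExecSet s₂, ρ = ρ₁ ++ ρ₂ }
  | .ite c s₁ s₂ =>
      (fun ρ => c.toLetter :: ρ) '' ExecSet s₁ ∪ (fun ρ => c.negLetter :: ρ) '' ExecSet s₂
  | .while c s =>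
      { ρ | ∃ bodies : List (Exec L V), (∀ b ∈ bodies, b ∈ ExecSet s) ∧
          ρ = (bodies.map (fun b => c.toLetter :: b)).flatten ++ [c.negLetter] }

/-- Quantifier-free postconditions. -/
inductive Post (L : FirstOrder.Language.{0,0}) (V : Type) : Type where
  | eq (x y : V)
  | rel {n : ℕ} (r : L.Relations n) (z : Fin n → V)
  | por (φ ψ : Post L V)
  | pnot (φ : Post L V)

/-- Truth of a postcondition in a structure under a valuation of the variables. -/
def Post.Holds (M : Struc L) (v : V → M.carrier) : Post L V → Prop
  | .eq x y => v x = v y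
  | .rel r z => @Structure.RelMap L M.carrier M.inst _ r (fun i => v (z i))
  | .por φ ψ => φ.Holds M v ∨ ψ.Holds M v
  | .pnot φ => ¬ φ.Holds M v

variable [DecidableEq V]

/-- A program satisfies a postcondition modulo axioms `A`. -/
def Satisfies (A : L.Theory) (init : V → L.Constants) (s : Prog L V) (φ : Post L V) : Prop :=
  ∀ M : Struc L, M.SatTheory A → ∀ ρ ∈ ExecSet s, FeasibleIn M init ρ →
    φ.Holds M (fun x => M.evalT (TEval init ρ x))

/-- A program is coherent modulo `A` if all its executions are. -/
def CoherentProg (A : L.Theory) (init : V → L.Constants) (s : Prog L V) : Prop :=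
  ∀ ρ ∈ ExecSet s, Coherent A init ρ

end PVMA
namespace PVMA

open FirstOrder FirstOrder.Language


variable {L : FirstOrder.Language.{0,0}} {V : Type}

/-! ### Relational closures and closure extensions -/

/-- The three closure kinds for relational axioms. -/
inductive ClosKind : Type where
  | refl
  | irref
  | symm

/-- The axiom corresponding to a closure kind. -/
def ClosKind.phi : ClosKind → (L.Relations 2) → L.Sentence
  | .refl => phiRefl
  | .irref => phiIrref
  | .symm => phiSymm

/-- The p-closure of a binary relation: the smallest reflexive/symmetric relation containing
it, respectively the largest irreflexive relation contained in it. -/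
def RelClos {α : Type} : ClosKind → (α → α → Prop) → (α → α → Prop)
  | .refl, r => fun a b => r a b ∨ a = b
  | .irref, r => fun a b => r a b ∧ a ≠ b
  | .symm, r => fun a b => r a b ∨ r b a

/-- The interpretation of a binary relation symbol in a structure, as a binary relation. -/
def Struc.rel2 (M : Struc L) (R : L.Relations 2) : M.carrier → M.carrier → Prop :=
  fun a b => @Structure.RelMap L M.carrier M.inst 2 R ![a, b]

open Classical in
/-- Replace the interpretation of the binary relation symbol `R` by the relation `r`. -/
noncomputable def Struc.withRel2 (M : Struc L) (R : L.Relations 2)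
    (r : M.carrier → M.carrier → Prop) : Struc L where
  carrier := M.carrier
  inst :=
    { funMap := fun f v => @Structure.funMap L M.carrier M.inst _ f v
      RelMap := fun {n} S v =>
        if h : (⟨n, S⟩ : Σ k, L.Relations k) = ⟨2, R⟩ then
          r (v (Fin.cast (congrArg Sigma.fst h).symm 0))
            (v (Fin.cast (congrArg Sigma.fst h).symm 1))
        else @Structure.RelMap L M.carrier M.inst n S v }
  nonempty := M.nonempty

/-- The (p,R)-closure extension of a structure. -/
noncomputable def closureExt (M : Struc L) (p : ClosKind) (R : L.Relations 2) : Struc L :=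
  M.withRel2 R (RelClos p (M.rel2 R))

/-- The (p,R)-transitive-closure extension of a structure. -/
noncomputable def transClosureExt (M : Struc L) (p : ClosKind) (R : L.Relations 2) : Struc L :=
  (closureExt M p R).withRel2 R (Relation.TransGen ((closureExt M p R).rel2 R))

/-- A theory is invariant under (p,R)-closure extension. -/
def InvariantClos (A : L.Theory) (p : ClosKind) (R : L.Relations 2) : Prop :=
  ∀ M : Struc L, M.SatTheory A → (closureExt M p R).SatTheory A

/-- A theory is invariant under (p,R)-transitive-closure extension. -/
def InvariantTransClos (A : L.Theory) (p : ClosKind) (R : L.Relations 2) : Prop :=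
  ∀ M : Struc L, M.SatTheory A → (transClosureExt M p R).SatTheory A

/-! ### The instrumentation homomorphisms h_p^R -/

/-- Auxiliary letters inserted by `h_refl^R` after a letter. -/
def reflExtra (R : L.Relations 2) : ProgLetter L V → List (ProgLetter L V)
  | .call x _ _ => [ProgLetter.assumeRel R ![x, x] ]
  | _ => []

/-- Auxiliary letters inserted by `h_irref^R` after a letter. -/
def irrefExtra (R : L.Relations 2) : ProgLetter L V → List (ProgLetter L V)
  | .call x _ _ => [ProgLetter.assumeNRel R ![x, x] ]
  | _ => []

open Classical in
/-- Auxiliary letters inserted by `h_symm^R` after a letter. -/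
noncomputable def symmExtra (R : L.Relations 2) : ProgLetter L V → List (ProgLetter L V)
  | .assumeRel (n := nn) r z =>
      if h : (⟨nn, r⟩ : Σ k, L.Relations k) = ⟨2, R⟩ then
        [ProgLetter.assumeRel R ![z (Fin.cast (congrArg Sigma.fst h).symm 1),
                                  z (Fin.cast (congrArg Sigma.fst h).symm 0)] ]
      else []
  | .assumeNRel (n := nn) r z =>
      if h : (⟨nn, r⟩ : Σ k, L.Relations k) = ⟨2, R⟩ then
        [ProgLetter.assumeNRel R ![z (Fin.cast (congrArg Sigma.fst h).symm 1),
                                   z (Fin.cast (congrArg Sigma.fst h).symm 0)] ]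
      else []
  | _ => []

/-- The homomorphism h_p^R applied to an execution. -/
noncomputable def hMap [Fintype V] (p : ClosKind) (R : L.Relations 2) (ρ : Exec L V) :
    Exec L V :=
  match p with
  | .refl =>
      ((Finset.univ : Finset V).toList.map fun x => ProgLetter.assumeRel R ![x, x]) ++
        (ρ.map fun a => a :: reflExtra R a).flatten
  | .irref => (ρ.map fun a => a :: irrefExtra R a).flatten
  | .symm => (ρ.map fun a => a :: symmExtra R a).flatten

/-! ### One element extensions and the homomorphisms for function axioms -/

/-- The one-element extension of a structure. -/
noncomputable def oneExt (M : Struc L) : Struc L where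
  carrier := Option M.carrier
  inst :=
    { funMap := fun {n} g v =>
        if h : ∀ i, (v i).isSome then
          some (@Structure.funMap L M.carrier M.inst n g fun i => (v i).get (h i))
        else none
      RelMap := fun {n} S v =>
        ∃ w : Fin n → M.carrier, (∀ i, v i = some (w i)) ∧
          @Structure.RelMap L M.carrier M.inst n S w }
  nonempty := ⟨none⟩

/-- A theory is invariant under one-element extension. -/
def Invariant1Ext (A : L.Theory) : Prop :=
  ∀ M : Struc L, M.SatTheory A → (oneExt M).SatTheory A

/-- Renaming the variables of a letter. -/
def ProgLetter.mapVar {W : Type} (j : V → W) : ProgLetter L V → ProgLetter L W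
  | .assign x y => .assign (j x) (j y)
  | .call x f z => .call (j x) f (j ∘ z)
  | .assumeEq x y => .assumeEq (j x) (j y)
  | .assumeNe x y => .assumeNe (j x) (j y)
  | .assumeRel r z => .assumeRel r (j ∘ z)
  | .assumeNRel r z => .assumeNRel r (j ∘ z)

open Classical in
/-- Auxiliary letters inserted by `h_idem^f` after a letter; `none` plays the role of
the fresh variable v*. -/
noncomputable def idemExtra (f : L.Functions 1) :
    ProgLetter L V → List (ProgLetter L (Option V))
  | .call x (n := nn) g _ =>
      if _ : (⟨nn, g⟩ : Σ k, L.Functions k) = ⟨1, f⟩ then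
        [ProgLetter.call none f ![some x], ProgLetter.assumeEq (some x) none]
      else []
  | _ => []

open Classical in
/-- Auxiliary letters inserted by `h_comm^f` after a letter; `none` plays the role of
the fresh variable v*. -/
noncomputable def commExtra (f : L.Functions 2) :
    ProgLetter L V → List (ProgLetter L (Option V))
  | .call x (n := nn) g z =>
      if h : (⟨nn, g⟩ : Σ k, L.Functions k) = ⟨2, f⟩ then
        [ProgLetter.call none f ![some (z (Fin.cast (congrArg Sigma.fst h).symm 1)),
                                  some (z (Fin.cast (congrArg Sigma.fst h).symm 0))],
         ProgLetter.assumeEq (some x) none]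
      else []
  | _ => []

/-- The homomorphism h_idem^f. -/
noncomputable def hIdem (f : L.Functions 1) (ρ : Exec L V) : Exec L (Option V) :=
  (ρ.map fun a => a.mapVar some :: idemExtra f a).flatten

/-- The homomorphism h_comm^f. -/
noncomputable def hComm (f : L.Functions 2) (ρ : Exec L V) : Exec L (Option V) :=
  (ρ.map fun a => a.mapVar some :: commExtra f a).flatten

/-- Extension of the initial-constants assignment to the fresh variable v*. -/
def extInit (init : V → L.Constants) (cstar : L.Constants) : Option V → L.Constants
  | some x => init x
  | none => cstar

/-! ### The minimal model -/

/-- Congruence closure of a set of pairs of ground terms. -/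
inductive CongCl (E : L.Term Empty → L.Term Empty → Prop) :
    L.Term Empty → L.Term Empty → Prop
  | base {t₁ t₂} : E t₁ t₂ → CongCl E t₁ t₂
  | refl (t) : CongCl E t t
  | symm {t₁ t₂} : CongCl E t₁ t₂ → CongCl E t₂ t₁
  | trans {t₁ t₂ t₃} : CongCl E t₁ t₂ → CongCl E t₂ t₃ → CongCl E t₁ t₃
  | congr {n : ℕ} (f : L.Functions n) {ts ss : Fin n → L.Term Empty} :
      (∀ i, CongCl E (ts i) (ss i)) → CongCl E (.func f ts) (.func f ss)

/-- The setoid of ground terms given by congruence closure. -/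
def congSetoid (E : L.Term Empty → L.Term Empty → Prop) : Setoid (L.Term Empty) :=
  ⟨CongCl E, ⟨fun t => .refl t, fun h => h.symm, fun h h' => h.trans h'⟩⟩

/-- The equality pairs contained in a set of ground literals. -/
def eqPairs (K : Set (GLit L)) : L.Term Empty → L.Term Empty → Prop :=
  fun t₁ t₂ => GLit.eq t₁ t₂ ∈ K

/-- The minimal model of an execution. -/
noncomputable def minimalModel [DecidableEq V] [Nonempty V]
    (init : V → L.Constants) (ρ : Exec L V) : Struc L :=
  let S : Setoid (L.Term Empty) := congSetoid (eqPairs (kappa init ρ))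
  { carrier := Quotient S
    inst :=
      { funMap := fun {n} f v => Quotient.mk S (Term.func f fun i => (v i).out)
        RelMap := fun {n} r v =>
          ∃ ts : Fin n → L.Term Empty,
            (∀ i, Quotient.mk S (ts i) = v i) ∧ GLit.rel r ts ∈ kappa init ρ }
    nonempty := ⟨Quotient.mk S (Constants.term (init (Classical.arbitrary V)))⟩ }

end PVMA
namespace PVMA

open FirstOrder FirstOrder.Language

variable {L : FirstOrder.Language.{0,0}}

/-! ### Encodings of inputs as natural numbers -/

/-- Encoding of lists of naturals. -/
def encL : List ℕ → ℕ := fun l => Encodable.encode l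

section Enc

variable (encF : (Σ n, L.Functions n) → ℕ) (encR : (Σ n, L.Relations n) → ℕ)

/-- Encoding of letters (variables are `Fin m`). -/
def encLetter {m : ℕ} : ProgLetter L (Fin m) → ℕ
  | .assign x y => encL [0, x.val, y.val]
  | .call x f z => encL [1, x.val, encF ⟨_, f⟩, encL (List.ofFn fun i => (z i).val)]
  | .assumeEq x y => encL [2, x.val, y.val]
  | .assumeNe x y => encL [3, x.val, y.val]
  | .assumeRel r z => encL [4, encR ⟨_, r⟩, encL (List.ofFn fun i => (z i).val)]
  | .assumeNRel r z => encL [5, encR ⟨_, r⟩, encL (List.ofFn fun i => (z i).val)]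

/-- Encoding of executions. -/
def encExec {m : ℕ} (ρ : Exec L (Fin m)) : ℕ := encL (ρ.map (encLetter encF encR))

/-- Encoding of atomic conditions. -/
def encCond {m : ℕ} : AtomCond L (Fin m) → ℕ
  | .eq x y => encL [0, x.val, y.val]
  | .ne x y => encL [1, x.val, y.val]
  | .rel r z => encL [2, encR ⟨_, r⟩, encL (List.ofFn fun i => (z i).val)]
  | .nrel r z => encL [3, encR ⟨_, r⟩, encL (List.ofFn fun i => (z i).val)]

/-- Encoding of programs. -/
def encProg {m : ℕ} : Prog L (Fin m) → ℕ
  | .skip => encL [0]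
  | .assign x y => encL [1, x.val, y.val]
  | .call x f z => encL [2, x.val, encF ⟨_, f⟩, encL (List.ofFn fun i => (z i).val)]
  | .passume c => encL [3, encCond encR c]
  | .seq s₁ s₂ => encL [4, encProg s₁, encProg s₂]
  | .ite c s₁ s₂ => encL [5, encCond encR c, encProg s₁, encProg s₂]
  | .while c s => encL [6, encCond encR c, encProg s]

/-- Encoding of postconditions. -/
def encPost {m : ℕ} : Post L (Fin m) → ℕ
  | .eq x y => encL [0, x.val, y.val]
  | .rel r z => encL [1, encR ⟨_, r⟩, encL (List.ofFn fun i => (z i).val)]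
  | .por φ ψ => encL [2, encPost φ, encPost ψ]
  | .pnot φ => encL [3, encPost φ]

/-- Encoding of the initial-constants assignment. -/
def encInit {m : ℕ} (init : Fin m → L.Constants) : ℕ :=
  encL (List.ofFn fun i => encF ⟨0, init i⟩)

/-- Encoding of a verification-problem input (V, init, program, postcondition). -/
def encVerifInput {m : ℕ} (init : Fin m → L.Constants) (s : Prog L (Fin m))
    (φ : Post L (Fin m)) : ℕ :=
  encL [m, encInit encF init, encProg encF encR s, encPost encR φ]

/-- Encoding of a coherence-checking input (V, init, program). -/
def encCohInput {m : ℕ} (init : Fin m → L.Constants) (s : Prog L (Fin m)) : ℕ :=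
  encL [m, encInit encF init, encProg encF encR s]

end Enc

/-! ### Concretely presented finite signatures -/

/-- A concretely presented finite signature: the multisets of arities of function and
relation symbols, presented as lists. -/
structure FinSig where
  funcs : List ℕ
  rels : List ℕ

/-- The first-order language of a concretely presented finite signature. -/
abbrev FinSig.lang (S : FinSig) : FirstOrder.Language.{0,0} :=
  ⟨fun n => Fin (S.funcs.count n), fun n => Fin (S.rels.count n)⟩

/-- Canonical encoding of function symbols. -/
def FinSig.encF (S : FinSig) : (Σ n, (S.lang).Functions n) → ℕ :=
  fun x => encL [x.1, x.2.val]

/-- Canonical encoding of relation symbols. -/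
def FinSig.encR (S : FinSig) : (Σ n, (S.lang).Relations n) → ℕ :=
  fun x => encL [x.1, x.2.val]

/-- Canonical encoding of a finite signature. -/
def FinSig.enc (S : FinSig) : ℕ := encL [encL S.funcs, encL S.rels]

/-! ### EPR sentences -/

/-- Function-free terms: a variable among `k` universally quantified ones, or a constant. -/
abbrev EPRTerm (L : FirstOrder.Language.{0,0}) (k : ℕ) : Type := L.Constants ⊕ Fin k

/-- Interpretation of an EPR term as a first-order term. -/
def EPRTerm.toTerm {k : ℕ} : EPRTerm L k → L.Term (Empty ⊕ Fin k)
  | .inl c => Constants.term c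
  | .inr i => Term.var (Sum.inr i)

/-- Quantifier-free, function-free formulas with `k` variables. -/
inductive QFF (L : FirstOrder.Language.{0,0}) (k : ℕ) : Type where
  | eq (s t : EPRTerm L k)
  | rel {n : ℕ} (r : L.Relations n) (z : Fin n → EPRTerm L k)
  | or (φ ψ : QFF L k)
  | not (φ : QFF L k)

/-- Interpretation of a quantifier-free relational formula as a bounded formula. -/
def QFF.toBF {k : ℕ} : QFF L k → L.BoundedFormula Empty k
  | .eq s t => Term.bdEqual s.toTerm t.toTerm
  | .rel r z => BoundedFormula.rel r (fun i => (z i).toTerm)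
  | .or φ ψ => φ.toBF ⊔ ψ.toBF
  | .not φ => ∼φ.toBF

/-- An EPR sentence: the universal closure of a quantifier-free relational formula. -/
structure EPRAx (L : FirstOrder.Language.{0,0}) : Type where
  k : ℕ
  body : QFF L k

/-- The sentence denoted by an EPR axiom. -/
def EPRAx.toSentence (a : EPRAx L) : L.Sentence := a.body.toBF.alls

/-- The theory given by a finite list of EPR axioms. -/
def eprTheory (A : List (EPRAx L)) : L.Theory := { φ | ∃ a ∈ A, a.toSentence = φ }

/-- Canonical encoding of EPR terms over a concretely presented signature. -/
def encEPRTerm (S : FinSig) {k : ℕ} : EPRTerm S.lang k → ℕ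
  | .inl c => encL [0, c.val]
  | .inr i => encL [1, i.val]

/-- Canonical encoding of quantifier-free relational formulas. -/
def encQFF (S : FinSig) {k : ℕ} : QFF S.lang k → ℕ
  | .eq s t => encL [0, encEPRTerm S s, encEPRTerm S t]
  | .rel (n := n) r z => encL [1, n, r.val, encL (List.ofFn fun i => encEPRTerm S (z i))]
  | .or φ ψ => encL [2, encQFF S φ, encQFF S ψ]
  | .not φ => encL [3, encQFF S φ]

/-- Canonical encoding of EPR axioms. -/
def encEPRAx (S : FinSig) (a : EPRAx S.lang) : ℕ := encL [a.k, encQFF S a.body]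

end PVMA

namespace PVMA.EPRReduction

/-! ### Codes for primitive recursive functions -/

/-- The list `l`, continued by the constant sequence `z`. -/
def pad {D : Type} (z : D) (l : List D) : ℕ → D := fun i => l.getD i z

/-- Prepend an entry to a sequence. -/
def scons {D : Type} (x : D) (a : ℕ → D) : ℕ → D
  | 0 => x
  | i + 1 => a i

/-- Remove the first entry of a sequence. -/
def tail {D : Type} (a : ℕ → D) : ℕ → D := fun i => a (i + 1)

section Sequences

variable {D : Type} (z x : D) (l : List D) (a : ℕ → D)

@[simp] theorem pad_cons_zero : pad z (x :: l) 0 = x := rfl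

@[simp] theorem pad_cons_succ (i : ℕ) : pad z (x :: l) (i + 1) = pad z l i := rfl

@[simp] theorem pad_cons_one : pad z (x :: l) 1 = pad z l 0 := rfl

@[simp] theorem pad_nil (i : ℕ) : pad z [] i = z := rfl

@[simp] theorem tail_pad_cons : tail (pad z (x :: l)) = pad z l := rfl

@[simp] theorem tail_scons : tail (scons x a) = a := rfl

@[simp] theorem scons_zero : scons x a 0 = x := rfl

theorem scons_pad : scons x (pad z l) = pad z (x :: l) := by
  funext i; cases i <;> rfl

theorem pad_map {E : Type} (f : D → E) (i : ℕ) : pad (f z) (l.map f) i = f (pad z l i) :=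
  List.getD_map ..

theorem map_range'_pad (l₁ l₂ l₃ : List D) :
    (List.range' l₁.length l₂.length).map (pad z (l₁ ++ (l₂ ++ l₃))) = l₂ := by
  refine List.ext_getElem (by simp) fun i hi _ => ?_
  have h : i < l₂.length := by simpa using hi
  simp [pad, List.getElem?_append, h]

end Sequences

/-- Codes for primitive recursive functions of `k` arguments. -/
inductive Code : ℕ → Type
  | zero : Code 0
  | succ : Code 1
  | get {k : ℕ} (i : ℕ) : Code k
  | comp {k m : ℕ} (f : Code m) (g : Fin m → Code k) : Code k
  | prec {k : ℕ} (f : Code k) (g : Code (k + 2)) : Code (k + 1)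

/-- The function denoted by a code; only the first `k` entries of the argument matter. -/
def Code.eval : {k : ℕ} → Code k → (ℕ → ℕ) → ℕ
  | _, .zero, _ => 0
  | _, .succ, a => a 0 + 1
  | _, .get i, a => a i
  | _, .comp f g, a => f.eval (pad 0 (List.ofFn fun i => (g i).eval a))
  | _, .prec f g, a =>
      Nat.rec (f.eval (tail a)) (fun y ih => g.eval (scons y (scons ih (tail a)))) (a 0)

/-- `c.Bounded n a`: every argument of a successor operation performed in the evaluation of `c`
at `a` is less than `n`. -/
def Code.Bounded (n : ℕ) : {k : ℕ} → Code k → (ℕ → ℕ) → Prop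
  | _, .zero, _ => True
  | _, .succ, a => a 0 < n
  | _, .get _, _ => True
  | _, .comp f g, a =>
      (∀ i, (g i).Bounded n a) ∧ f.Bounded n (pad 0 (List.ofFn fun i => (g i).eval a))
  | _, .prec f g, a =>
      Nat.rec (f.Bounded n (tail a))
        (fun y ih => ih ∧
          g.Bounded n (scons y (scons ((Code.prec f g).eval (scons y (tail a))) (tail a)))) (a 0)

open Filter in
theorem Code.eventually_bounded {k : ℕ} (c : Code k) :
    ∀ a : ℕ → ℕ, ∀ᶠ n in atTop, c.Bounded n a := by
  induction c with
  | zero => exact fun _ => .of_forall fun _ => trivial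
  | succ => exact fun a => eventually_gt_atTop (a 0)
  | get => exact fun _ => .of_forall fun _ => trivial
  | comp f g ihf ihg =>
    exact fun a => (eventually_all.2 fun i => ihg i a).and (ihf _)
  | prec f g ihf ihg =>
    intro a
    simp only [Code.Bounded]
    induction a 0 with
    | zero => exact ihf _
    | succ y ih => exact ih.and (ihg _)

theorem exists_code_of_primrec {k : ℕ} {f : List.Vector ℕ k → ℕ} (hf : Nat.Primrec' f) :
    ∃ c : Code k, ∀ v, c.eval (pad 0 v.toList) = f v := by
  induction hf with
  | zero => exact ⟨.zero, fun _ => rfl⟩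
  | succ =>
    refine ⟨.succ, fun v => ?_⟩
    obtain ⟨x, t, rfl⟩ := v.exists_eq_cons
    simp [Code.eval]
  | get i =>
    refine ⟨.get i, fun v => ?_⟩
    simp [Code.eval, pad, List.Vector.get_eq_get_toList]
  | comp g _ _ ihf ihg =>
    obtain ⟨cf, hcf⟩ := ihf
    choose cg hcg using ihg
    refine ⟨.comp cf cg, fun v => ?_⟩
    simp [Code.eval, hcg, ← hcf]
  | prec _ _ ihf ihg =>
    obtain ⟨cf, hcf⟩ := ihf
    obtain ⟨cg, hcg⟩ := ihg
    refine ⟨.prec cf cg, fun v => ?_⟩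
    obtain ⟨x, t, rfl⟩ := v.exists_eq_cons
    simp [Code.eval, ← hcf, ← hcg, scons_pad]

/-! ### Horn clauses describing the evaluation of codes -/

/-- The predicates occurring in the clauses: the flag guarding all the axioms, the property of
not being the end of the chain, the successor relation of the chain, the input, demanded and
computed values of a code, and candidates reached in the search for a zero of a code. -/
inductive Pred : Type
  | flag
  | bound
  | succ
  | input
  | need {k : ℕ} (c : Code k)
  | val {k : ℕ} (c : Code k)
  | search

/-- Atoms; variables are natural numbers, and the variable `0` stands for the constant. -/
structure Atom : Type where
  pred : Pred
  args : List ℕ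

/-- Truth of an atom under an interpretation of the predicates and a valuation. -/
def Atom.Holds {D : Type} (z : D) (W : Pred → (ℕ → D) → Prop) (env : ℕ → D) (a : Atom) : Prop :=
  W a.pred (pad z (a.args.map env))

/-- Horn clauses. -/
structure Clause : Type where
  body : List Atom
  head : Atom

/-- Validity of a clause. -/
def Clause.Holds {D : Type} (z : D) (W : Pred → (ℕ → D) → Prop) (cl : Clause) : Prop :=
  ∀ env : ℕ → D, env 0 = z → (∀ a ∈ cl.body, a.Holds z W env) → cl.head.Holds z W env

/-- The variables used for the arguments of a code. -/
def argVars (k : ℕ) : List ℕ := List.range' 5 k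

/-- The clauses which describe the demand-driven evaluation of a code. -/
def Code.clauses : {k : ℕ} → Code k → List Clause
  | _, .zero =>
      [⟨[⟨.need .zero, []⟩], ⟨.val .zero, [0]⟩⟩]
  | _, .succ =>
      [⟨[⟨.need .succ, [1]⟩], ⟨.bound, [1]⟩⟩,
       ⟨[⟨.need .succ, [1]⟩, ⟨.succ, [1, 2]⟩], ⟨.val .succ, [2, 1]⟩⟩]
  | k, .get i =>
      [⟨[⟨.need (.get i : Code k), argVars k⟩],
        ⟨.val (.get i : Code k), (argVars k).getD i 0 :: argVars k⟩⟩]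
  | k, .comp (m := m) f g =>
      f.clauses ++ (List.ofFn fun i => (g i).clauses).flatten ++
      (List.ofFn fun i => ⟨[⟨.need (.comp f g), argVars k⟩], ⟨.need (g i), argVars k⟩⟩) ++
      [⟨⟨.need (.comp f g), argVars k⟩ ::
          List.ofFn fun i => ⟨.val (g i), (5 + k + i) :: argVars k⟩,
        ⟨.need f, List.range' (5 + k) m⟩⟩,
       ⟨⟨.need (.comp f g), argVars k⟩ :: ⟨.val f, 1 :: List.range' (5 + k) m⟩ ::
          List.ofFn fun i => ⟨.val (g i), (5 + k + i) :: argVars k⟩,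
        ⟨.val (.comp f g), 1 :: argVars k⟩⟩]
  | _, .prec (k := k) f g =>
      f.clauses ++ g.clauses ++
      [⟨[⟨.need (.prec f g), 2 :: argVars k⟩, ⟨.succ, [1, 2]⟩],
        ⟨.need (.prec f g), 1 :: argVars k⟩⟩,
       ⟨[⟨.need (.prec f g), 0 :: argVars k⟩], ⟨.need f, argVars k⟩⟩,
       ⟨[⟨.need (.prec f g), 0 :: argVars k⟩, ⟨.val f, 3 :: argVars k⟩],
        ⟨.val (.prec f g), 3 :: 0 :: argVars k⟩⟩,
       ⟨[⟨.need (.prec f g), 2 :: argVars k⟩, ⟨.succ, [1, 2]⟩,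
          ⟨.val (.prec f g), 3 :: 1 :: argVars k⟩],
        ⟨.need g, 1 :: 3 :: argVars k⟩⟩,
       ⟨[⟨.need (.prec f g), 2 :: argVars k⟩, ⟨.succ, [1, 2]⟩,
          ⟨.val (.prec f g), 3 :: 1 :: argVars k⟩, ⟨.val g, 4 :: 1 :: 3 :: argVars k⟩],
        ⟨.val (.prec f g), 4 :: 2 :: argVars k⟩⟩]

/-- The clauses which search for the least `y` with `p(y, x) = 0`, where `x` is the input. -/
def searchClauses (p : Code 2) : List Clause :=
  p.clauses ++
  [⟨[⟨.input, [1]⟩], ⟨.search, [1, 0]⟩⟩,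
   ⟨[⟨.search, [1, 2]⟩], ⟨.need p, [2, 1]⟩⟩,
   ⟨[⟨.search, [1, 2]⟩, ⟨.val p, [4, 2, 1]⟩, ⟨.succ, [3, 4]⟩], ⟨.bound, [2]⟩⟩,
   ⟨[⟨.search, [1, 2]⟩, ⟨.val p, [4, 2, 1]⟩, ⟨.succ, [3, 4]⟩, ⟨.succ, [2, 5]⟩],
    ⟨.search, [1, 5]⟩⟩]

/-! ### The standard interpretation of the clauses -/

/-- The standard interpretation over the natural numbers, for a chain of length `n`, the input `x`
and the search bound `b`. -/
def standard (n x b : ℕ) : Pred → (ℕ → ℕ) → Prop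
  | .flag, _ => True
  | .bound, a => a 0 < n
  | .succ, a => a 1 = a 0 + 1
  | .input, a => a 0 = x
  | .need c, a => c.Bounded n a
  | .val c, a => a 0 = c.eval (tail a)
  | .search, a => a 0 = x ∧ a 1 ≤ b

theorem standard_clauses (n x b : ℕ) {k : ℕ} (c : Code k) :
    ∀ cl ∈ c.clauses, cl.Holds 0 (standard n x b) := by
  induction c with
  | zero =>
    intro cl hcl env h0
    simp only [Code.clauses, List.mem_cons, List.not_mem_nil, or_false] at hcl
    subst hcl
    simp [Atom.Holds, standard, h0, Code.eval]
  | succ =>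
    intro cl hcl env h0
    simp only [Code.clauses, List.mem_cons, List.not_mem_nil, or_false] at hcl
    rcases hcl with rfl | rfl <;> simp [Atom.Holds, standard, Code.eval, Code.Bounded]
  | get i =>
    intro cl hcl env h0
    simp only [Code.clauses, List.mem_cons, List.not_mem_nil, or_false] at hcl
    subst hcl
    simp only [Atom.Holds, standard, Code.eval, List.map_cons, pad_cons_zero, tail_pad_cons]
    intro _
    exact (h0 ▸ pad_map 0 (argVars _) env i).symm
  | @comp k m f g ihf ihg =>
    have key : ∀ env : ℕ → ℕ,
        (∀ a ∈ List.ofFn fun i : Fin m => (⟨.val (g i), (5 + k + i) :: argVars k⟩ : Atom),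
          a.Holds 0 (standard n x b) env) →
        (List.range' (5 + k) m).map env =
          List.ofFn fun i => (g i).eval (pad 0 ((argVars k).map env)) := by
      intro env h
      refine List.ext_getElem (by simp) fun i hi hi' => ?_
      have hm : i < m := by simpa using hi
      have := h _ (List.mem_ofFn.2 ⟨⟨i, hm⟩, rfl⟩)
      simpa [Atom.Holds, standard] using this
    intro cl hcl
    simp only [Code.clauses, List.mem_append, List.mem_flatten, List.mem_ofFn, List.mem_cons,
      List.not_mem_nil, or_false] at hcl
    rcases hcl with ((hcl | ⟨_, ⟨i, rfl⟩, hcl⟩) | ⟨i, rfl⟩) | rfl | rfl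
    · exact ihf cl hcl
    · exact ihg i cl hcl
    · intro env h0 hb
      have := hb _ (List.mem_cons_self ..)
      exact this.1 i
    · intro env h0 hb
      have h1 := hb _ (List.mem_cons_self ..)
      have h2 := key env fun a ha => hb a (List.mem_cons_of_mem _ ha)
      simp only [Atom.Holds, standard, h2]
      exact h1.2
    · intro env h0 hb
      have h1 := hb _ (List.mem_cons_of_mem _ (List.mem_cons_self ..))
      have h2 := key env fun a ha => hb a (List.mem_cons_of_mem _ (List.mem_cons_of_mem _ ha))
      simp only [Atom.Holds, standard, List.map_cons, pad_cons_zero, tail_pad_cons, h2,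
        Code.eval] at h1 ⊢
      exact h1
  | @prec k f g ihf ihg =>
    intro cl hcl
    simp only [Code.clauses, List.mem_append, List.mem_cons, List.not_mem_nil, or_false] at hcl
    rcases hcl with (hcl | hcl) | rfl | rfl | rfl | rfl | rfl
    · exact ihf cl hcl
    · exact ihg cl hcl
    all_goals
      intro env h0 hb
      simp only [List.forall_mem_cons, List.not_mem_nil, false_imp_iff, implies_true, and_true,
        Atom.Holds, standard, Code.Bounded, Code.eval, List.map_cons, List.map_nil, pad_cons_zero,
        tail_pad_cons, pad_cons_one, scons_pad, h0] at hb ⊢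
    · obtain ⟨h1, h2⟩ := hb
      rw [h2] at h1
      exact h1.1
    · exact hb
    · exact hb.2
    · obtain ⟨h1, h2, h3⟩ := hb
      rw [h2] at h1
      rw [h3]
      exact h1.2
    · obtain ⟨h1, h2, h3, h4⟩ := hb
      rw [h2, h4, h3]

theorem standard_searchClauses {n x b : ℕ} {p : Code 2} (hb : p.eval (pad 0 [b, x]) = 0)
    (hmin : ∀ y < b, p.eval (pad 0 [y, x]) ≠ 0)
    (hbd : ∀ y ≤ b, p.Bounded n (pad 0 [y, x])) (hn : b ≤ n) :
    ∀ cl ∈ searchClauses p, cl.Holds 0 (standard n x b) := by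
  have key : ∀ y y', y ≤ b → y' + 1 = p.eval (pad 0 [y, x]) → y < b := by
    intro y y' hy h
    refine lt_of_le_of_ne hy ?_
    rintro rfl
    omega
  intro cl hcl
  simp only [searchClauses, List.mem_append, List.mem_cons, List.not_mem_nil, or_false] at hcl
  rcases hcl with hcl | rfl | rfl | rfl | rfl
  · exact standard_clauses n x b p cl hcl
  all_goals
    intro env h0 h
    simp only [List.forall_mem_cons, List.not_mem_nil, false_imp_iff, implies_true, and_true,
      Atom.Holds, standard, List.map_cons, List.map_nil, pad_cons_zero,
      tail_pad_cons, pad_cons_one, h0] at h ⊢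
  · exact ⟨h, b.zero_le⟩
  · rw [h.1]
    exact hbd _ h.2
  · obtain ⟨⟨h1, h2⟩, h3, h4⟩ := h
    rw [h1, h4] at h3
    exact (key _ _ h2 h3).trans_le hn
  · obtain ⟨⟨h1, h2⟩, h3, h4, h5⟩ := h
    rw [h1, h4] at h3
    rw [h5]
    exact ⟨h1, key _ _ h2 h3⟩

/-! ### Soundness of the clauses along a chain -/

section Chain

variable {D : Type} {W : Pred → (ℕ → D) → Prop} {e : ℕ → D} {n : ℕ}

/-- The values of the argument variables under a valuation given by a list. -/
theorem map_argVars (d₁ d₂ d₃ d₄ : D) {k : ℕ} {l : List D} (hl : l.length = k) (r : List D) :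
    (argVars k).map (pad (e 0) (e 0 :: d₁ :: d₂ :: d₃ :: d₄ :: (l ++ r))) = l := by
  subst hl
  exact map_range'_pad (e 0) [e 0, d₁, d₂, d₃, d₄] l r

theorem eval_sound (hS : ∀ i < n, W .succ (pad (e 0) [e i, e (i + 1)]))
    (hB : ¬ W .bound (pad (e 0) [e n])) {k : ℕ} (c : Code k) :
    (∀ cl ∈ c.clauses, cl.Holds (e 0) W) → ∀ l : List ℕ, l.length = k → (∀ x ∈ l, x ≤ n) →
      W (.need c) (pad (e 0) (l.map e)) →
      c.eval (pad 0 l) ≤ n ∧ W (.val c) (pad (e 0) ((c.eval (pad 0 l) :: l).map e)) := by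
  induction c with
  | zero =>
    intro hC l hl hn hW
    obtain rfl := List.eq_nil_of_length_eq_zero hl
    refine ⟨n.zero_le, ?_⟩
    have := hC _ (List.mem_cons_self ..) (fun _ => e 0) rfl
    simpa [Atom.Holds, Code.eval] using this (by simpa [Atom.Holds] using hW)
  | succ =>
    intro hC l hl hn hW
    obtain ⟨x, rfl⟩ := List.length_eq_one_iff.1 hl
    simp only [Code.clauses, List.forall_mem_cons, List.not_mem_nil, false_imp_iff, implies_true,
      and_true] at hC
    have h1 := hC.1 (pad (e 0) [e 0, e x]) rfl
    have h2 := hC.2 (pad (e 0) [e 0, e x, e (x + 1)]) rfl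
    simp only [List.forall_mem_cons, List.not_mem_nil, false_imp_iff, implies_true, and_true,
      Atom.Holds, List.map_cons, List.map_nil, pad_cons_one, pad_cons_zero] at h1 h2 hW
    have hx : x < n := by
      refine lt_of_le_of_ne (hn x (List.mem_cons_self ..)) ?_
      rintro rfl
      exact hB (h1 hW)
    exact ⟨hx, h2 ⟨hW, hS x hx⟩⟩
  | @get k i =>
    intro hC l hl hn hW
    have hi : pad 0 l i ≤ n := by
      rcases lt_or_ge i l.length with h | h
      · simpa [pad, h] using hn _ (List.getElem_mem h)
      · simp [pad, h]
    refine ⟨hi, ?_⟩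
    have h := hC _ (List.mem_cons_self ..)
      (pad (e 0) (e 0 :: e 0 :: e 0 :: e 0 :: e 0 :: (l.map e ++ []))) rfl
    have hm := map_argVars (e := e) (e 0) (e 0) (e 0) (e 0) (l := l.map e) (k := k)
      (by simpa using hl) []
    have hg : pad (e 0) (e 0 :: e 0 :: e 0 :: e 0 :: e 0 :: (l.map e ++ []))
        ((argVars k).getD i 0) = e (pad 0 l i) := by
      refine (pad_map 0 (argVars k) (pad (e 0) (e 0 :: e 0 :: e 0 :: e 0 :: e 0 ::
        (l.map e ++ []))) i).symm.trans ?_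
      rw [hm]
      exact pad_map 0 l e i
    simp only [List.forall_mem_cons, List.not_mem_nil, false_imp_iff, implies_true, and_true,
      Atom.Holds, List.map_cons, hm, hg] at h
    exact h hW
  | @comp k m f g ihf ihg =>
    intro hC l hl hn hW
    simp only [Code.clauses, List.forall_mem_append, List.forall_mem_cons, List.not_mem_nil,
      false_imp_iff, implies_true, and_true, List.forall_mem_flatten, List.forall_mem_ofFn_iff]
      at hC
    obtain ⟨⟨⟨hf, hg⟩, h1⟩, h2, h3⟩ := hC
    set ys := List.ofFn fun i => (g i).eval (pad 0 l) with hys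
    let env (d : D) : ℕ → D :=
      pad (e 0) (e 0 :: d :: e 0 :: e 0 :: e 0 :: (l.map e ++ (ys.map e ++ [])))
    have hm : ∀ d, (argVars k).map (env d) = l.map e := fun d =>
      map_argVars _ _ _ _ (by simpa using hl) _
    have hy : ∀ d, (List.range' (5 + k) m).map (env d) = ys.map e := by
      intro d
      have := map_range'_pad (e 0) (e 0 :: d :: e 0 :: e 0 :: e 0 :: l.map e) (ys.map e) []
      have h5 : (e 0 :: d :: e 0 :: e 0 :: e 0 :: l.map e).length = 5 + k := by
        simp only [List.length_cons, List.length_map, hl]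
        omega
      rw [h5] at this
      simpa [hys, env] using this
    have hyi : ∀ d (i : Fin m), env d (5 + k + i) = e ((g i).eval (pad 0 l)) := by
      intro d i
      have := congrArg (fun l => l[(i : ℕ)]?) (hy d)
      simpa [hys] using this
    have hneed : ∀ i, W (.need (g i)) (pad (e 0) (l.map e)) := by
      intro i
      have := h1 i (env (e 0)) rfl
      simp only [List.forall_mem_cons, List.not_mem_nil, false_imp_iff, implies_true, and_true,
        Atom.Holds, hm] at this
      exact this hW
    have hval := fun i => ihg i (hg i) l hl hn (hneed i)
    have hfn : W (.need f) (pad (e 0) (ys.map e)) := by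
      have := h2 (env (e 0)) rfl
      simp only [List.forall_mem_cons, Atom.Holds, hm, hy, List.forall_mem_ofFn_iff,
        List.map_cons, hyi] at this
      exact this ⟨hW, fun i => (hval i).2⟩
    have hfv := ihf hf ys (by simp [hys]) (by
      intro y hy
      obtain ⟨i, rfl⟩ := List.mem_ofFn.1 hy
      exact (hval i).1) hfn
    refine ⟨hfv.1, ?_⟩
    have := h3 (env (e (f.eval (pad 0 ys)))) rfl
    have hd : ∀ d, env d 1 = d := fun _ => rfl
    simp only [List.forall_mem_cons, Atom.Holds, hm, hy, List.forall_mem_ofFn_iff,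
      List.map_cons, hyi, hd] at this
    exact this ⟨hW, hfv.2, fun i => (hval i).2⟩
  | @prec k f g ihf ihg =>
    intro hC l hl hn hW
    obtain ⟨x, t, rfl⟩ := List.exists_of_length_succ l hl
    simp only [Code.clauses, List.forall_mem_append, List.forall_mem_cons, List.not_mem_nil,
      false_imp_iff, implies_true, and_true] at hC
    obtain ⟨⟨hf, hg⟩, h1, h2, h3, h4, h5⟩ := hC
    have ht : t.length = k := by simpa using hl
    have htn : ∀ y ∈ t, y ≤ n := fun y hy => hn y (List.mem_cons_of_mem _ hy)
    let env (d₁ d₂ d₃ d₄ : D) : ℕ → D :=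
      pad (e 0) (e 0 :: d₁ :: d₂ :: d₃ :: d₄ :: (t.map e ++ []))
    have hm : ∀ d₁ d₂ d₃ d₄, (argVars k).map (env d₁ d₂ d₃ d₄) = t.map e :=
      fun d₁ d₂ d₃ d₄ => map_argVars d₁ d₂ d₃ d₄ (by simpa using ht) []
    have e0 : ∀ d₁ d₂ d₃ d₄, env d₁ d₂ d₃ d₄ 0 = e 0 := fun _ _ _ _ => rfl
    have e1 : ∀ d₁ d₂ d₃ d₄, env d₁ d₂ d₃ d₄ 1 = d₁ := fun _ _ _ _ => rfl
    have e2 : ∀ d₁ d₂ d₃ d₄, env d₁ d₂ d₃ d₄ 2 = d₂ := fun _ _ _ _ => rfl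
    have e3 : ∀ d₁ d₂ d₃ d₄, env d₁ d₂ d₃ d₄ 3 = d₃ := fun _ _ _ _ => rfl
    have e4 : ∀ d₁ d₂ d₃ d₄, env d₁ d₂ d₃ d₄ 4 = d₄ := fun _ _ _ _ => rfl
    have hx : x ≤ n := hn x (List.mem_cons_self ..)
    clear hn hl
    induction x with
    | zero =>
      have h2 := h2 (env (e 0) (e 0) (e 0) (e 0)) rfl
      have h3 := h3 (env (e 0) (e 0) (e (f.eval (pad 0 t))) (e 0)) rfl
      simp only [List.forall_mem_cons, List.not_mem_nil, false_imp_iff, implies_true, and_true,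
        Atom.Holds, hm, List.map_cons, e0, e3] at h2 h3
      have hv := ihf hf t ht htn (h2 hW)
      exact ⟨hv.1, h3 ⟨hW, hv.2⟩⟩
    | succ x ih =>
      have hs := hS x hx
      have h1 := h1 (env (e x) (e (x + 1)) (e 0) (e 0)) rfl
      simp only [List.forall_mem_cons, List.not_mem_nil, false_imp_iff, implies_true, and_true,
        Atom.Holds, hm, List.map_cons, List.map_nil, e1, e2] at h1
      obtain ⟨hyn, hy⟩ := ih (h1 ⟨hW, hs⟩) (Nat.le_of_succ_le hx)
      set y := (Code.prec f g).eval (pad 0 (x :: t)) with hydef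
      have hev : (Code.prec f g).eval (pad 0 ((x + 1) :: t)) = g.eval (pad 0 (x :: y :: t)) := by
        simp only [hydef, Code.eval, scons_pad, tail_pad_cons, pad_cons_zero]
      have h4 := h4 (env (e x) (e (x + 1)) (e y) (e 0)) rfl
      have h5 := h5 (env (e x) (e (x + 1)) (e y) (e (g.eval (pad 0 (x :: y :: t))))) rfl
      simp only [List.forall_mem_cons, List.not_mem_nil, false_imp_iff, implies_true, and_true,
        Atom.Holds, hm, List.map_cons, List.map_nil, e1, e2, e3, e4] at h4 h5
      have hv := ihg hg (x :: y :: t) (by simp [ht]) (by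
        simp only [List.forall_mem_cons]
        exact ⟨Nat.le_of_succ_le hx, hyn, htn⟩) (h4 ⟨hW, hs, hy⟩)
      rw [hev]
      exact ⟨hv.1, h5 ⟨hW, hs, hy, hv.2⟩⟩

theorem search_sound (hS : ∀ i < n, W .succ (pad (e 0) [e i, e (i + 1)]))
    (hB : ¬ W .bound (pad (e 0) [e n])) {p : Code 2}
    (hC : ∀ cl ∈ searchClauses p, cl.Holds (e 0) W) {x : ℕ} (hx : x ≤ n)
    (hI : W .input (pad (e 0) [e x])) : ∃ y, p.eval (pad 0 [y, x]) = 0 := by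
  by_contra! hne
  simp only [searchClauses, List.forall_mem_append, List.forall_mem_cons, List.not_mem_nil,
    false_imp_iff, implies_true, and_true] at hC
  obtain ⟨hp, h1, h2, h3, h4⟩ := hC
  have step : ∀ y ≤ n, W .search (pad (e 0) [e x, e y]) →
      ∃ u < n, p.eval (pad 0 [y, x]) = u + 1 ∧ W (.val p) (pad (e 0) [e (u + 1), e y, e x]) := by
    intro y hy h
    have h2 := h2 (pad (e 0) [e 0, e x, e y]) rfl
    simp only [List.forall_mem_cons, List.not_mem_nil, false_imp_iff, implies_true, and_true,
      Atom.Holds, List.map_cons, List.map_nil, pad_cons_one, pad_cons_zero] at h2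
    have hv := eval_sound hS hB p hp [y, x] rfl (by simp [hx, hy]) (h2 h)
    obtain ⟨u, hu⟩ := Nat.exists_eq_succ_of_ne_zero (hne y)
    rw [hu] at hv
    exact ⟨u, hv.1, hu, hv.2⟩
  have reach : ∀ y ≤ n, W .search (pad (e 0) [e x, e y]) := by
    intro y
    induction y with
    | zero =>
      intro _
      have h1 := h1 (pad (e 0) [e 0, e x]) rfl
      simp only [List.forall_mem_cons, List.not_mem_nil, false_imp_iff, implies_true, and_true,
        Atom.Holds, List.map_cons, List.map_nil, pad_cons_one, pad_cons_zero] at h1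
      exact h1 hI
    | succ y ih =>
      intro hy
      have hs := ih (Nat.le_of_succ_le hy)
      obtain ⟨u, hu, -, hv⟩ := step y (Nat.le_of_succ_le hy) hs
      have h4 := h4 (pad (e 0) [e 0, e x, e y, e u, e (u + 1), e (y + 1)]) rfl
      simp only [List.forall_mem_cons, List.not_mem_nil, false_imp_iff, implies_true, and_true,
        Atom.Holds, List.map_cons, List.map_nil] at h4
      exact h4 ⟨hs, hv, hS u hu, hS y hy⟩
  have hs := reach n le_rfl
  obtain ⟨u, hu, -, hv⟩ := step n le_rfl hs
  have h3 := h3 (pad (e 0) [e 0, e x, e n, e u, e (u + 1)]) rfl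
  simp only [List.forall_mem_cons, List.not_mem_nil, false_imp_iff, implies_true, and_true,
    Atom.Holds, List.map_cons, List.map_nil] at h3
  exact hB (h3 ⟨hs, hv, hS u hu⟩)

end Chain


open FirstOrder FirstOrder.Language

attribute [local instance] Struc.inst

/-! ### The signature and the axioms -/

/-- The signature with a constant, a unary function symbol, and a relation symbol of arity `K`
for every predicate in `ps`. -/
def sig (ps : List Pred) (K : ℕ) : FinSig := ⟨[0, 1], List.replicate (ps.length + 1) K⟩

section Signature

variable {ps : List Pred} {K : ℕ}

/-- The constant symbol. -/
def cst : (sig ps K).lang.Constants := (⟨0, Nat.zero_lt_one⟩ : Fin 1)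

/-- The function symbol. -/
def fn : (sig ps K).lang.Functions 1 := (⟨0, Nat.zero_lt_one⟩ : Fin 1)

open Classical in
/-- The relation symbol of a predicate. -/
noncomputable def relOf (p : Pred) : (sig ps K).lang.Relations K :=
  ⟨ps.idxOf p, by simpa [sig, Nat.lt_succ_iff] using List.idxOf_le_length⟩

/-- The terms obtained by iterating the function symbol on the constant. -/
def numeral : ℕ → (sig ps K).lang.Term Empty
  | 0 => Constants.term cst
  | i + 1 => Term.func fn fun _ => numeral i

/-- The interpretation of the predicates in a structure. -/
def interp (M : Struc (sig ps K).lang) (p : Pred) (a : ℕ → M.carrier) : Prop :=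
  @Structure.RelMap _ M.carrier M.inst K (relOf p) fun i => a i

/-- The EPR term of a variable. -/
def varTerm (N : ℕ) : ℕ → EPRTerm (sig ps K).lang N
  | 0 => .inl cst
  | i + 1 => if h : i < N then .inr ⟨i, h⟩ else .inl cst

/-- The formula of an atom. -/
noncomputable def Atom.toQFF (N : ℕ) (a : Atom) : QFF (sig ps K).lang N :=
  .rel (relOf a.pred) fun i : Fin K => varTerm N (pad 0 a.args i)

/-- The axiom of a clause, guarded by the flag. -/
noncomputable def Clause.toAx (N : ℕ) (cl : Clause) : EPRAx (sig ps K).lang :=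
  ⟨N, .or (.not (Atom.toQFF N ⟨.flag, []⟩))
    (cl.body.foldr (fun a q => .or (.not (a.toQFF N)) q) (cl.head.toQFF N))⟩

/-- The valuation of the variables given by values of the first `N` ones. -/
def envOf {D : Type} (z : D) {N : ℕ} (xs : Fin N → D) : ℕ → D
  | 0 => z
  | i + 1 => if h : i < N then xs ⟨i, h⟩ else z

variable (M : Struc (sig ps K).lang) {N : ℕ}

theorem realize_varTerm (xs : Fin N → M.carrier) (i : ℕ) :
    @Term.realize _ M.carrier M.inst _ (Sum.elim Empty.elim xs) (varTerm N i).toTerm =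
      envOf (M.evalT (numeral 0)) xs i := by
  have hc : Term.realize (Sum.elim Empty.elim xs)
      (Constants.term (cst : (sig ps K).lang.Constants)) = M.evalT (numeral 0) := by
    simp [Struc.evalT, numeral]
  cases i with
  | zero => exact hc
  | succ i =>
    simp only [varTerm, envOf]
    split
    · rfl
    · exact hc

theorem realize_toQFF (xs : Fin N → M.carrier) (a : Atom) :
    @BoundedFormula.Realize _ M.carrier M.inst _ _ (a.toQFF N).toBF Empty.elim xs ↔
      a.Holds (M.evalT (numeral 0)) (interp M) (envOf (M.evalT (numeral 0)) xs) := by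
  refine Iff.of_eq (congrArg (Structure.RelMap (relOf a.pred)) (funext fun i => ?_))
  exact (realize_varTerm M xs _).trans (pad_map 0 a.args _ i).symm

theorem sat_toAx (cl : Clause) :
    M.Sat (cl.toAx N).toSentence ↔
      (interp M .flag (fun _ => M.evalT (numeral 0)) → ∀ xs : Fin N → M.carrier,
        (∀ a ∈ cl.body,
          a.Holds (M.evalT (numeral 0)) (interp M) (envOf (M.evalT (numeral 0)) xs)) →
        cl.head.Holds (M.evalT (numeral 0)) (interp M) (envOf (M.evalT (numeral 0)) xs)) := by
  have hbody : ∀ (xs : Fin N → M.carrier) (body : List Atom) (head : Atom),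
      (BoundedFormula.Realize (QFF.toBF (L := (sig ps K).lang)
        (body.foldr (fun a q => .or (.not (a.toQFF N)) q) (head.toQFF N))) Empty.elim xs ↔
        ((∀ a ∈ body,
          a.Holds (M.evalT (numeral 0)) (interp M) (envOf (M.evalT (numeral 0)) xs)) →
        head.Holds (M.evalT (numeral 0)) (interp M) (envOf (M.evalT (numeral 0)) xs))) := by
    intro xs body head
    induction body with
    | nil => simpa using realize_toQFF M xs head
    | cons a body ih =>
      simp only [List.foldr_cons, QFF.toBF, BoundedFormula.realize_sup,
        BoundedFormula.realize_not, ih, realize_toQFF M, List.forall_mem_cons]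
      tauto
  have hflag : ∀ xs : Fin N → M.carrier, (⟨.flag, []⟩ : Atom).Holds (M.evalT (numeral 0))
      (interp M) (envOf (M.evalT (numeral 0)) xs) ↔
      interp M .flag (fun _ => M.evalT (numeral 0)) := fun _ => Iff.rfl
  have hv : (default : Empty → M.carrier) = Empty.elim := Subsingleton.elim _ _
  rw [Struc.Sat, Sentence.Realize, EPRAx.toSentence, BoundedFormula.realize_alls, hv]
  simp only [Clause.toAx, QFF.toBF, BoundedFormula.realize_sup, BoundedFormula.realize_not,
    realize_toQFF M, hbody, hflag]
  exact ⟨fun h hf xs => (h xs).resolve_left (not_not.2 hf), fun h xs => by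
    by_cases hf : interp M .flag (fun _ => M.evalT (numeral 0))
    · exact Or.inr (h hf xs)
    · exact Or.inl hf⟩

end Signature

/-! ### Structures over the natural numbers -/

section NatStruc

variable {ps : List Pred} {K N : ℕ} {W : Pred → (ℕ → ℕ) → Prop} {cls : List Clause}

/-- The natural numbers with zero and successor, and with given predicates. -/
def natStruc (ps : List Pred) (K : ℕ) (W : Pred → (ℕ → ℕ) → Prop) : Struc (sig ps K).lang where
  carrier := ℕ
  inst :=
    { funMap := fun {n} _ v => if h : 0 < n then v ⟨0, h⟩ + 1 else 0
      RelMap := fun {n} (r : Fin _) v =>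
        ∃ p, ps[r.val]? = some p ∧ W p fun i => if h : i < n then v ⟨i, h⟩ else 0 }
  nonempty := ⟨0⟩

theorem evalT_numeral (W : Pred → (ℕ → ℕ) → Prop) (i : ℕ) :
    (natStruc ps K W).evalT (numeral i) = i := by
  induction i with
  | zero => rfl
  | succ i ih => exact congrArg Nat.succ ih

theorem interp_natStruc {p : Pred} (hp : p ∈ ps) {l : List ℕ} (hl : l.length ≤ K) :
    interp (natStruc ps K W) p (pad (D := ℕ) 0 l) ↔ W p (pad 0 l) := by
  classical
  have hidx : ps[ps.idxOf p]? = some p := by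
    rw [List.getElem?_eq_getElem (List.idxOf_lt_length_of_mem hp), List.getElem_idxOf]
  have hpad : (fun i => if h : i < K then pad 0 l ((⟨i, h⟩ : Fin K) : ℕ) else 0) = pad 0 l := by
    funext i
    split
    · rfl
    · simp [pad, List.getElem?_eq_none (hl.trans (Nat.le_of_not_lt ‹_›))]
  have hr : interp (natStruc ps K W) p (pad (D := ℕ) 0 l) ↔ ∃ q, ps[ps.idxOf p]? = some q ∧
      W q fun i => if h : i < K then pad 0 l ((⟨i, h⟩ : Fin K) : ℕ) else 0 := Iff.rfl
  rw [hr, hidx, hpad]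
  simp

/-- The atom is built from the given predicates, arities and variables. -/
def Atom.Fits (ps : List Pred) (K N : ℕ) (a : Atom) : Prop :=
  a.pred ∈ ps ∧ a.args.length ≤ K ∧ ∀ v ∈ a.args, v ≤ N

/-- The clause is built from the given predicates, arities and variables. -/
def Clause.Fits (ps : List Pred) (K N : ℕ) (cl : Clause) : Prop :=
  (∀ a ∈ cl.body, a.Fits ps K N) ∧ cl.head.Fits ps K N

theorem exists_fits (cls : List Clause) (qs : List Pred) (k : ℕ) :
    ∃ ps K N, qs ⊆ ps ∧ k ≤ K ∧ ∀ cl ∈ cls, cl.Fits ps K N := by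
  let atoms := cls.flatMap fun cl => cl.head :: cl.body
  refine ⟨qs ++ atoms.map Atom.pred, k + (atoms.map fun a => a.args.length).sum,
    (atoms.flatMap Atom.args).sum, List.subset_append_left .., Nat.le_add_right .., ?_⟩
  have key : ∀ a ∈ atoms, a.Fits (qs ++ atoms.map Atom.pred)
      (k + (atoms.map fun a => a.args.length).sum) (atoms.flatMap Atom.args).sum := fun a ha =>
    ⟨List.mem_append_right _ (List.mem_map_of_mem ha),
      le_add_left (List.le_sum_of_mem (List.mem_map_of_mem (f := fun a => a.args.length) ha)),
      fun v hv => List.le_sum_of_mem (List.mem_flatMap.2 ⟨a, ha, hv⟩)⟩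
  exact fun cl hcl => ⟨fun a ha => key a (List.mem_flatMap.2 ⟨cl, hcl, List.mem_cons_of_mem _ ha⟩),
    key _ (List.mem_flatMap.2 ⟨cl, hcl, List.mem_cons_self ..⟩)⟩

/-- The axioms of a list of clauses. -/
noncomputable def clauseAxs (ps : List Pred) (K N : ℕ) (cls : List Clause) :
    List (EPRAx (sig ps K).lang) :=
  cls.map (Clause.toAx N)

theorem satTheory_natStruc (hfit : ∀ cl ∈ cls, cl.Fits ps K N) (hflag : .flag ∈ ps)
    (h : W .flag (pad 0 []) → ∀ cl ∈ cls, cl.Holds 0 W) :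
    (natStruc ps K W).SatTheory (eprTheory (clauseAxs ps K N cls)) := by
  rintro _ ⟨_, hmem, rfl⟩
  obtain ⟨cl, hcl, rfl⟩ := List.mem_map.1 hmem
  rw [sat_toAx]
  simp only [evalT_numeral]
  have hatom : ∀ (a : Atom) (env : ℕ → ℕ), a.Fits ps K N →
      (a.Holds (D := ℕ) 0 (interp (natStruc ps K W)) env ↔ a.Holds 0 W env) := fun a env ha =>
    interp_natStruc ha.1 (by simpa using ha.2.1)
  intro hf xs hb
  have hf := (interp_natStruc (l := []) hflag K.zero_le).1 hf
  refine (hatom _ _ (hfit cl hcl).2).2 (h hf cl hcl _ rfl fun a ha => ?_)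
  exact (hatom _ _ ((hfit cl hcl).1 a ha)).1 (hb a ha)

theorem holds_of_satTheory (hfit : ∀ cl ∈ cls, cl.Fits ps K N) {M : Struc (sig ps K).lang}
    (hM : M.SatTheory (eprTheory (clauseAxs ps K N cls)))
    (hflag : interp M .flag (fun _ => M.evalT (numeral 0))) :
    ∀ cl ∈ cls, cl.Holds (M.evalT (numeral 0)) (interp M) := by
  intro cl hcl env h0 hb
  have h := (sat_toAx M cl).1 (hM _ ⟨cl.toAx N, List.mem_map_of_mem hcl, rfl⟩) hflag
    fun i => env (i + 1)
  have henv : ∀ i ≤ N, envOf (M.evalT (numeral 0)) (fun i : Fin N => env (i + 1)) i = env i := by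
    intro i hi
    cases i with
    | zero => exact h0.symm
    | succ i => simp [envOf, Nat.lt_of_succ_le hi]
  have hatom : ∀ a : Atom, a.Fits ps K N → (a.Holds (M.evalT (numeral 0)) (interp M)
      (envOf (M.evalT (numeral 0)) fun i : Fin N => env (i + 1)) ↔
      a.Holds (M.evalT (numeral 0)) (interp M) env) := by
    intro a ha
    rw [Atom.Holds, Atom.Holds, List.map_congr_left fun v hv => henv v (ha.2.2 v hv)]
  exact (hatom _ (hfit cl hcl).2).1 (h fun a ha => (hatom _ ((hfit cl hcl).1 a ha)).2 (hb a ha))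

end NatStruc

/-! ### Feasibility along an execution -/

section Feasibility

variable {L : FirstOrder.Language.{0, 0}} {V : Type} [DecidableEq V]

/-- Feasibility of an execution which starts in a given state. -/
def FeasibleFrom (M : Struc L) : (V → L.Term Empty) → Exec L V → Prop
  | _, [] => True
  | st, a :: ρ => (∀ l, litOf st a = some l → M.SatLit l) ∧ FeasibleFrom M (stepState st a) ρ

theorem feasibleFrom_iff (M : Struc L) (st : V → L.Term Empty) (ρ : Exec L V) :
    FeasibleFrom M st ρ ↔ ∀ σ a, (σ ++ [a]) <+: ρ → ∀ l, litOf (σ.foldl stepState st) a = some l →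
      M.SatLit l := by
  induction ρ generalizing st with
  | nil => simp [FeasibleFrom]
  | cons b ρ ih =>
    rw [FeasibleFrom, ih]
    constructor
    · rintro ⟨h0, h⟩ (_ | ⟨c, σ⟩) a hp
      · obtain rfl : a = b := by simpa using hp
        exact h0
      · obtain ⟨hc, hp'⟩ := List.cons_prefix_cons.1 hp
        subst hc
        exact h σ a hp'
    · exact fun h => ⟨h [] b (by simp),
        fun σ a hp => h (b :: σ) a (List.cons_prefix_cons.2 ⟨rfl, hp⟩)⟩

theorem feasibleFrom_append (M : Struc L) (st : V → L.Term Empty) (ρ ρ' : Exec L V) :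
    FeasibleFrom M st (ρ ++ ρ') ↔
      FeasibleFrom M st ρ ∧ FeasibleFrom M (ρ.foldl stepState st) ρ' := by
  induction ρ generalizing st with
  | nil => simp [FeasibleFrom]
  | cons b ρ ih => simp [FeasibleFrom, ih, and_assoc]

end Feasibility

/-! ### The program -/

section Program

variable {ps : List Pred} {K : ℕ}

/-- The arguments of an atomic condition of the program. -/
def args (l : List (Fin 3)) : Fin K → Fin 3 := fun i => pad 0 l i

/-- The atomic condition for a predicate. -/
noncomputable def cond (p : Pred) (l : List (Fin 3)) : AtomCond (sig ps K).lang (Fin 3) :=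
  .rel (relOf p) (args l)

/-- The part of the program which prolongs the chain by one element. -/
noncomputable def stepProg : Prog (sig ps K).lang (Fin 3) :=
  .seq (.call 2 fn fun _ => 1) (.seq (.passume (cond .succ [1, 2])) (.assign 1 2))

/-- The part of the program which builds a chain of a given length. -/
noncomputable def prefixProg : ℕ → Prog (sig ps K).lang (Fin 3)
  | 0 => .skip
  | k + 1 => .seq stepProg (prefixProg k)

/-- The part of the program after the input has been reached. -/
noncomputable def mainProg : Prog (sig ps K).lang (Fin 3) :=
  .seq (.passume (cond .input [1])) (.while (cond .bound [1]) stepProg)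

/-- The program for the input `x`. -/
noncomputable def prog (x : ℕ) : Prog (sig ps K).lang (Fin 3) := .seq (prefixProg x) mainProg

/-- The postcondition: the flag does not hold. -/
noncomputable def postcond : Post (sig ps K).lang (Fin 3) := .pnot (.rel (relOf .flag) (args []))

/-- The execution of `stepProg`. -/
noncomputable def stepWord : Exec (sig ps K).lang (Fin 3) :=
  [.call 2 fn fun _ => 1, (cond .succ [1, 2]).toLetter, .assign 1 2]

/-- The execution of `prog x` in which the body of the loop is executed `j` times. -/
noncomputable def runWord (x j : ℕ) : Exec (sig ps K).lang (Fin 3) :=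
  (List.replicate x stepWord).flatten ++ ((cond .input [1]).toLetter ::
    ((List.replicate j ((cond .bound [1]).toLetter :: stepWord)).flatten ++
      [(cond .bound [1]).negLetter]))

theorem mem_execSet_stepProg (ρ : Exec (sig ps K).lang (Fin 3)) :
    ρ ∈ ExecSet stepProg ↔ ρ = stepWord := by
  simp [stepProg, ExecSet, stepWord]

theorem mem_execSet_prefixProg (k : ℕ) (ρ : Exec (sig ps K).lang (Fin 3)) :
    ρ ∈ ExecSet (prefixProg k) ↔ ρ = (List.replicate k stepWord).flatten := by
  induction k generalizing ρ with
  | zero => simp [prefixProg, ExecSet]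
  | succ k ih => simp [prefixProg, ExecSet, ih, mem_execSet_stepProg, List.replicate_succ]

theorem mem_execSet_prog (x : ℕ) (ρ : Exec (sig ps K).lang (Fin 3)) :
    ρ ∈ ExecSet (prog x) ↔ ∃ j, ρ = runWord x j := by
  have hw : ∀ ρ : Exec (sig ps K).lang (Fin 3),
      ρ ∈ ExecSet (.while (cond .bound [1]) stepProg) ↔
      ∃ j, ρ = (List.replicate j ((cond .bound [1]).toLetter :: stepWord)).flatten ++
        [(cond .bound [1]).negLetter] := by
    intro ρ
    constructor
    · rintro ⟨bodies, hb, rfl⟩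
      refine ⟨bodies.length, ?_⟩
      have : bodies = List.replicate bodies.length stepWord :=
        List.eq_replicate_iff.2 ⟨rfl, fun b h => (mem_execSet_stepProg b).1 (hb b h)⟩
      conv_lhs => rw [this]
      rw [List.map_replicate]
    · rintro ⟨j, rfl⟩
      refine ⟨List.replicate j stepWord, fun b h => ?_, by rw [List.map_replicate]⟩
      exact (mem_execSet_stepProg b).2 (List.eq_of_mem_replicate h)
  constructor
  · rintro ⟨ρ₁, h₁, _, ⟨ρ₂, h₂, ρ₃, h₃, rfl⟩, rfl⟩
    obtain ⟨j, rfl⟩ := (hw _).1 h₃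
    rw [(mem_execSet_prefixProg _ _).1 h₁, Set.mem_singleton_iff.1 h₂]
    exact ⟨j, rfl⟩
  · rintro ⟨j, rfl⟩
    exact ⟨_, (mem_execSet_prefixProg _ _).2 rfl, _, ⟨_, rfl, _, (hw _).2 ⟨j, rfl⟩, rfl⟩, rfl⟩

/-- The initial constants of the variables. -/
def initConst : Fin 3 → (sig ps K).lang.Constants := fun _ => cst

/-- The state after a chain of length `i` has been built. -/
def state (i : ℕ) : Fin 3 → (sig ps K).lang.Term Empty :=
  fun v => if v = 0 then numeral 0 else numeral i

theorem foldl_stepWord (i : ℕ) :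
    (stepWord : Exec (sig ps K).lang (Fin 3)).foldl stepState (state i) = state (i + 1) := by
  funext v
  fin_cases v <;> rfl

theorem state_zero : (state 0 : Fin 3 → (sig ps K).lang.Term Empty) =
    fun x => Constants.term (initConst x) := by
  funext v
  simp [state, numeral, initConst]

variable (M : Struc (sig ps K).lang)

/-- The truth of a predicate at the end of the chain of length `i`. -/
def atEnd (p : Pred) (i : ℕ) : Prop :=
  interp M p (pad (M.evalT (numeral 0)) [M.evalT (numeral i)])

/-- The truth of the successor relation between the elements of the chain at `i` and `i + 1`. -/
def link (i : ℕ) : Prop :=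
  interp M .succ (pad (M.evalT (numeral 0)) [M.evalT (numeral i), M.evalT (numeral (i + 1))])

theorem relMap_atEnd (p : Pred) (i : ℕ) :
    Structure.RelMap (M := M.carrier) (relOf p : (sig ps K).lang.Relations K)
      (fun k => M.evalT (state i (args [1] k))) ↔ atEnd M p i :=
  Iff.of_eq (congrArg (Structure.RelMap (M := M.carrier) (relOf p))
    (funext fun k => (pad_map 0 [1] (fun v => M.evalT (state i v)) k).symm))

theorem feasibleFrom_toLetter (p : Pred) (i : ℕ) (ρ : Exec (sig ps K).lang (Fin 3)) :
    FeasibleFrom M (state i) ((cond p [1]).toLetter :: ρ) ↔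
      atEnd M p i ∧ FeasibleFrom M (state i) ρ := by
  refine and_congr ?_ Iff.rfl
  simpa [cond, AtomCond.toLetter, litOf, Struc.SatLit] using relMap_atEnd M p i

theorem feasibleFrom_negLetter (p : Pred) (i : ℕ) :
    FeasibleFrom M (state i) [(cond p [1]).negLetter] ↔ ¬ atEnd M p i := by
  refine (and_iff_left trivial).trans ?_
  simpa [cond, AtomCond.negLetter, litOf, Struc.SatLit] using (relMap_atEnd M p i).not

theorem feasibleFrom_stepWord (i : ℕ) : FeasibleFrom M (state i) stepWord ↔ link M i := by
  have hm : Structure.RelMap (M := M.carrier) (relOf .succ : (sig ps K).lang.Relations K)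
      (fun k => M.evalT (stepState (state i) (.call 2 fn fun _ => 1) (args [1, 2] k))) ↔
      link M i :=
    Iff.of_eq (congrArg (Structure.RelMap (M := M.carrier) (relOf .succ)) (funext fun k =>
      (pad_map 0 [1, 2]
        (fun v => M.evalT (stepState (state i) (.call 2 fn fun _ => 1) v)) k).symm))
  simpa [FeasibleFrom, stepWord, litOf, cond, AtomCond.toLetter, Struc.SatLit] using hm

theorem feasibleFrom_replicate_stepWord (x i : ℕ) (ρ : Exec (sig ps K).lang (Fin 3)) :
    FeasibleFrom M (state i) ((List.replicate x stepWord).flatten ++ ρ) ↔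
      (∀ t < x, link M (i + t)) ∧ FeasibleFrom M (state (i + x)) ρ := by
  induction x generalizing i with
  | zero => simp
  | succ x ih =>
    rw [List.replicate_succ, List.flatten_cons, List.append_assoc, feasibleFrom_append,
      feasibleFrom_stepWord, foldl_stepWord, ih, Nat.forall_lt_succ_left, and_assoc]
    simp only [Nat.add_right_comm i 1, Nat.add_assoc, Nat.add_zero]

theorem feasibleFrom_replicate_loop (j i : ℕ) (ρ : Exec (sig ps K).lang (Fin 3)) :
    FeasibleFrom M (state i)
        ((List.replicate j ((cond .bound [1]).toLetter :: stepWord)).flatten ++ ρ) ↔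
      (∀ t < j, atEnd M .bound (i + t) ∧ link M (i + t)) ∧ FeasibleFrom M (state (i + j)) ρ := by
  induction j generalizing i with
  | zero => simp
  | succ j ih =>
    rw [List.replicate_succ, List.flatten_cons, List.append_assoc, List.cons_append,
      feasibleFrom_toLetter, feasibleFrom_append,
      feasibleFrom_stepWord, foldl_stepWord, ih, Nat.forall_lt_succ_left]
    simp only [Nat.add_right_comm i 1, Nat.add_assoc, Nat.add_zero, and_assoc]

theorem feasibleIn_run (x j : ℕ) :
    FeasibleIn M initConst (runWord x j) ↔
      (∀ t < x, link M t) ∧ atEnd M .input x ∧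
        (∀ t < j, atEnd M .bound (x + t) ∧ link M (x + t)) ∧ ¬ atEnd M .bound (x + j) := by
  have h : FeasibleIn M initConst (runWord x j) ↔ FeasibleFrom M (state 0) (runWord x j) := by
    rw [feasibleFrom_iff, state_zero]
    exact Iff.rfl
  rw [h, runWord, feasibleFrom_replicate_stepWord, feasibleFrom_toLetter, feasibleFrom_replicate_loop,
    feasibleFrom_negLetter]
  simp only [Nat.zero_add]

/-! ### Coherence of the program -/

/-- The letters occurring in the executions of the program. -/
def Simple (a : ProgLetter (sig ps K).lang (Fin 3)) : Prop :=
  a = .call 2 fn (fun _ => 1) ∨ a = .assign 1 2 ∨ IsAssume a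

theorem simple_of_mem_run (x j : ℕ) :
    ∀ a ∈ (runWord x j : Exec (sig ps K).lang (Fin 3)), Simple a := by
  have hs : ∀ a ∈ (stepWord : Exec (sig ps K).lang (Fin 3)), Simple a := by
    simp only [stepWord, List.forall_mem_cons]
    exact ⟨.inl rfl, .inr (.inr trivial), .inr (.inl rfl), by simp⟩
  simp only [runWord, List.forall_mem_append, List.forall_mem_cons, List.forall_mem_flatten]
  refine ⟨fun l hl => ?_, .inr (.inr trivial), fun l hl => ?_, .inr (.inr trivial), by simp⟩
  · rwa [List.eq_of_mem_replicate hl]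
  · rw [List.eq_of_mem_replicate hl, List.forall_mem_cons]
    exact ⟨.inr (.inr trivial), hs⟩

theorem tEval_concat (σ : Exec (sig ps K).lang (Fin 3)) (a : ProgLetter (sig ps K).lang (Fin 3)) :
    TEval initConst (σ ++ [a]) = stepState (TEval initConst σ) a := by
  simp [TEval]

theorem mem_termsOf_concat {σ : Exec (sig ps K).lang (Fin 3)}
    {a : ProgLetter (sig ps K).lang (Fin 3)} {t : (sig ps K).lang.Term Empty}
    (h : t ∈ TermsOf initConst (σ ++ [a])) :
    t ∈ TermsOf initConst σ ∨ ∃ x, TEval initConst (σ ++ [a]) x = t := by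
  obtain ⟨τ, x, hτ, rfl⟩ := h
  rcases List.prefix_concat_iff.1 hτ with rfl | hτ
  · exact .inr ⟨x, rfl⟩
  · exact .inl ⟨τ, x, hτ, rfl⟩

theorem exists_numeral (σ : Exec (sig ps K).lang (Fin 3)) (hσ : ∀ a ∈ σ, Simple a) :
    ∃ i k, (k = i ∨ k = i + 1) ∧ TEval initConst σ 0 = numeral 0 ∧
      TEval initConst σ 1 = numeral i ∧ TEval initConst σ 2 = numeral k ∧
      ∀ t ∈ TermsOf initConst σ, ∃ j ≤ k, t = numeral j := by
  have hfin : ∀ (σ : Exec (sig ps K).lang (Fin 3)) {i k : ℕ}, (k = i ∨ k = i + 1) →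
      TEval initConst σ 0 = numeral 0 → TEval initConst σ 1 = numeral i →
      TEval initConst σ 2 = numeral k → ∀ x, ∃ j ≤ k, TEval initConst σ x = numeral j := by
    intro σ i k hik h0 h1 h2 x
    fin_cases x
    · exact ⟨0, k.zero_le, h0⟩
    · exact ⟨i, by omega, h1⟩
    · exact ⟨k, le_rfl, h2⟩
  induction σ using List.reverseRecOn with
  | nil =>
    refine ⟨0, 0, .inl rfl, rfl, rfl, rfl, ?_⟩
    rintro _ ⟨τ, x, hτ, rfl⟩
    rw [List.prefix_nil.1 hτ]
    exact ⟨0, le_rfl, rfl⟩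
  | append_singleton σ a ih =>
    obtain ⟨i, k, hik, h0, h1, h2, ht⟩ := ih fun b hb => hσ b (List.mem_append_left _ hb)
    have hext : ∀ {i' k' : ℕ}, k ≤ k' → (k' = i' ∨ k' = i' + 1) →
        TEval initConst (σ ++ [a]) 0 = numeral 0 → TEval initConst (σ ++ [a]) 1 = numeral i' →
        TEval initConst (σ ++ [a]) 2 = numeral k' →
        ∃ i k, (k = i ∨ k = i + 1) ∧ TEval initConst (σ ++ [a]) 0 = numeral 0 ∧
          TEval initConst (σ ++ [a]) 1 = numeral i ∧ TEval initConst (σ ++ [a]) 2 = numeral k ∧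
          ∀ t ∈ TermsOf initConst (σ ++ [a]), ∃ j ≤ k, t = numeral j := by
      intro i' k' hk hik' h0' h1' h2'
      refine ⟨i', k', hik', h0', h1', h2', fun t hmem => ?_⟩
      rcases mem_termsOf_concat hmem with hmem | ⟨x, rfl⟩
      · obtain ⟨j, hj, rfl⟩ := ht t hmem
        exact ⟨j, hj.trans hk, rfl⟩
      · exact hfin _ hik' h0' h1' h2' x
    rcases hσ a (by simp) with rfl | rfl | ha
    · refine hext (i' := i) (k' := i + 1) (by omega) (.inr rfl) ?_ ?_ ?_ <;> rw [tEval_concat]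
      · exact h0
      · exact h1
      · exact congrArg (Term.func fn) (funext fun _ => h1)
    · refine hext (i' := k) (k' := k) le_rfl (.inl rfl) ?_ ?_ ?_ <;> rw [tEval_concat]
      · exact h0
      · exact h2
      · exact h2
    · have hst : TEval initConst (σ ++ [a]) = TEval initConst σ := by
        rw [tEval_concat]
        cases a <;> first | rfl | exact ha.elim
      exact hext (i' := i) (k' := k) le_rfl hik (hst ▸ h0) (hst ▸ h1) (hst ▸ h2)

theorem coherent_of_simple {A : (sig ps K).lang.Theory} {W : Pred → (ℕ → ℕ) → Prop}
    {ρ : Exec (sig ps K).lang (Fin 3)} (hA : (natStruc ps K W).SatTheory A)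
    (hρ : FeasibleIn (natStruc ps K W) initConst ρ) (hs : ∀ a ∈ ρ, Simple a) :
    Coherent A initConst ρ := by
  have hinj : ∀ {σ : Exec (sig ps K).lang (Fin 3)} {i j : ℕ}, σ <+: ρ →
      EntailsEq A (kappa initConst σ) (numeral i) (numeral j) → i = j := by
    intro σ i j hσ h
    have h := h _ hA (by
      rintro l ⟨τ, a, hτ, hl⟩
      exact hρ τ a (hτ.trans hσ) l hl)
    rwa [evalT_numeral, evalT_numeral] at h
  constructor
  · rintro σ x n f z hp ⟨t, ht, h⟩
    have hσ : σ <+: ρ := (List.prefix_append _ _).trans hp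
    obtain ⟨i, k, hik, -, h1, h2, hterm⟩ := exists_numeral σ fun a ha => hs a (hσ.subset ha)
    rcases hs _ (hp.subset (List.mem_append_right _ (List.mem_cons_self ..))) with hc | hc | hc
    · cases hc
      obtain ⟨j, hj, rfl⟩ := hterm t ht
      have hf : (Term.func fn fun _ : Fin 1 => TEval initConst σ 1) =
          (numeral (i + 1) : (sig ps K).lang.Term Empty) :=
        congrArg (Term.func fn) (funext fun _ => h1)
      rw [hf] at h ⊢
      have := hinj hσ h
      refine ⟨2, ?_⟩
      rw [h2, show k = i + 1 by omega]
      exact fun _ _ _ => rfl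
    · cases hc
    · exact hc.elim
  · intro σ a hp _ t ht _ t' ht' h
    have hσ : σ <+: ρ := (List.prefix_append _ _).trans hp
    obtain ⟨i, k, -, -, -, -, hterm⟩ := exists_numeral σ fun a ha => hs a (hσ.subset ha)
    obtain ⟨j, -, rfl⟩ := hterm t ht
    obtain ⟨j', -, rfl⟩ := hterm t' ht'
    rw [hinj hp h]
    exact fun _ _ _ => rfl

end Program

/-! ### Correctness of the reduction -/

section Correctness

variable {ps : List Pred} {K N : ℕ} {p : Code 2}

theorem feasibleIn_natStruc {W : Pred → (ℕ → ℕ) → Prop} {x j b : ℕ}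
    (hps : [.flag, .bound, .succ, .input] ⊆ ps) (hK : 2 ≤ K)
    (hW : ∀ q a, q ≠ .flag → (W q a ↔ standard (x + j) x b q a)) :
    FeasibleIn (natStruc ps K W) initConst (runWord x j) := by
  have hend : ∀ q ∈ ps, ∀ i, q ≠ .flag →
      (atEnd (natStruc ps K W) q i ↔ standard (x + j) x b q (pad 0 [i])) := by
    intro q hq i hf
    rw [← hW q _ hf, atEnd]
    simp only [evalT_numeral]
    exact interp_natStruc (l := [i]) hq (by simp; omega)
  have hlink : ∀ i, link (natStruc ps K W) i := by
    intro i
    simp only [link, evalT_numeral]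
    refine (interp_natStruc (l := [i, i + 1]) (hps (by simp)) (by simpa using hK)).2 ?_
    exact (hW _ _ (by simp)).2 rfl
  rw [feasibleIn_run, hend _ (hps (by simp)) _ (by simp), hend _ (hps (by simp)) _ (by simp)]
  refine ⟨fun t _ => hlink t, rfl, fun t ht => ⟨?_, hlink _⟩, lt_irrefl (x + j)⟩
  rw [hend _ (hps (by simp)) _ (by simp)]
  exact Nat.add_lt_add_left ht x

theorem coherentProg_prog (hps : [.flag, .bound, .succ, .input] ⊆ ps) (hK : 2 ≤ K)
    {cls : List Clause} (hfit : ∀ cl ∈ cls, cl.Fits ps K N) (x : ℕ) :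
    CoherentProg (eprTheory (clauseAxs ps K N cls)) initConst (prog x) := by
  intro ρ hρ
  obtain ⟨j, rfl⟩ := (mem_execSet_prog x ρ).1 hρ
  refine coherent_of_simple (W := fun q a => q ≠ .flag ∧ standard (x + j) x 0 q a)
    (satTheory_natStruc hfit (hps (by simp)) fun h => (h.1 rfl).elim)
    (feasibleIn_natStruc (b := 0) hps hK fun q a hq => and_iff_right hq) (simple_of_mem_run x j)

theorem postcond_holds (M : Struc (sig ps K).lang) (v : Fin 3 → M.carrier) :
    postcond.Holds M v ↔ ¬ interp M .flag (fun _ => v 0) := Iff.rfl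

theorem tEval_run_zero (x j : ℕ) :
    TEval initConst (runWord x j : Exec (sig ps K).lang (Fin 3)) 0 = numeral 0 := by
  obtain ⟨-, -, -, h, -⟩ := exists_numeral (runWord x j) (simple_of_mem_run (ps := ps) (K := K) x j)
  exact h

open Filter in
theorem satisfies_prog_iff (hps : [.flag, .bound, .succ, .input] ⊆ ps) (hK : 2 ≤ K)
    (hfit : ∀ cl ∈ searchClauses p, cl.Fits ps K N) (x : ℕ) :
    Satisfies (eprTheory (clauseAxs ps K N (searchClauses p))) initConst (prog x) postcond ↔
      ¬ ∃ y, p.eval (pad 0 [y, x]) = 0 := by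
  constructor
  · intro hsat hex
    classical
    have hb := Nat.find_spec hex
    set b := Nat.find hex with hbdef
    have hev : ∀ᶠ n in atTop, ∀ y ∈ Set.Iic b, p.Bounded n (pad 0 [y, x]) :=
      (eventually_all_finite (Set.finite_Iic b)).2 fun y _ => p.eventually_bounded _
    obtain ⟨n, hn, hbn, hxn⟩ :=
      (hev.and ((eventually_ge_atTop b).and (eventually_ge_atTop x))).exists
    obtain ⟨j, rfl⟩ := Nat.exists_eq_add_of_le hxn
    have hM := satTheory_natStruc (W := standard (x + j) x b) hfit (hps (by simp)) fun _ =>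
      standard_searchClauses hb (fun y hy => Nat.find_min hex hy) (fun y hy => hn y hy) hbn
    have h := hsat _ hM _ ((mem_execSet_prog x _).2 ⟨j, rfl⟩)
      (feasibleIn_natStruc (b := b) hps hK fun _ _ _ => Iff.rfl)
    rw [postcond_holds, tEval_run_zero] at h
    simp only [evalT_numeral] at h
    exact h ((interp_natStruc (l := []) (hps (by simp)) K.zero_le).2 trivial)
  · intro hne M hM ρ hρ hfeas
    obtain ⟨j, rfl⟩ := (mem_execSet_prog x ρ).1 hρ
    rw [postcond_holds, tEval_run_zero]
    intro hflag
    obtain ⟨h1, h2, h3, h4⟩ := (feasibleIn_run M x j).1 hfeas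
    refine hne (search_sound (e := fun i => M.evalT (numeral i)) (n := x + j) (fun i hi => ?_) h4
      (holds_of_satTheory hfit hM hflag) (Nat.le_add_right x j) h2)
    rcases lt_or_ge i x with h | h
    · exact h1 i h
    · obtain ⟨t, rfl⟩ := Nat.exists_eq_add_of_le h
      exact (h3 t (by omega)).2

end Correctness

/-! ### Computability of the reduction -/

theorem primrec_input (ps : List Pred) (K N : ℕ) (cls : List Clause) :
    Primrec fun x => encL [(sig ps K).enc,
      encL ((clauseAxs ps K N cls).map (encEPRAx (sig ps K))),
      encVerifInput (sig ps K).encF (sig ps K).encR initConst (prog x) postcond] := by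
  have hcons : ∀ {f : ℕ → ℕ} {l : ℕ → List ℕ}, Primrec f → Primrec l →
      Primrec fun x => f x :: l x := fun hf hl => Primrec.list_cons.comp hf hl
  have henc : ∀ {l : ℕ → List ℕ}, Primrec l → Primrec fun x => encL (l x) := fun hl =>
    Primrec.encode.comp hl
  have hpre : Primrec fun x => encProg (sig ps K).encF (sig ps K).encR (prefixProg x) := by
    refine (Primrec.nat_rec₁ (f := fun _ ih =>
      encL [4, encProg (sig ps K).encF (sig ps K).encR stepProg, ih])
      (encProg (sig ps K).encF (sig ps K).encR (prefixProg 0)) ?_).of_eq fun x => ?_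
    · exact (henc (hcons (.const _) (hcons (.const _) (hcons .id (.const []))))).comp Primrec.snd
    · induction x with
      | zero => rfl
      | succ x ih => exact congrArg (fun m => encL [4, _, m]) ih
  exact henc (hcons (.const _) (hcons (.const _) (hcons (henc (hcons (.const _) (hcons (.const _)
    (hcons (henc (hcons (.const _) (hcons hpre (hcons (.const _) (.const [])))))
    (hcons (.const _) (.const [])))))) (.const []))))

/-- Halting of a program on the input `0` is the existence of a zero of a code. -/
theorem exists_code_halting : ∃ p : Code 2, ∀ c : Nat.Partrec.Code,
    (∃ y, p.eval (pad 0 [y, Encodable.encode c]) = 0) ↔ (c.eval 0).Dom := by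
  have hprim : Primrec₂ fun k c : ℕ =>
      if (Nat.Partrec.Code.evaln k (Denumerable.ofNat Nat.Partrec.Code c) 0).isSome
        then 0 else 1 := by
    refine Primrec.ite ?_ (Primrec.const 0) (Primrec.const 1)
    exact Primrec.primrecPred ((Primrec.option_isSome.comp (Nat.Partrec.Code.primrec_evaln.comp
      ((Primrec.fst.pair ((Primrec.ofNat _).comp .snd)).pair (.const 0)))).of_eq
      fun _ => Bool.decide_eq_true.symm)
  obtain ⟨p, hp⟩ := exists_code_of_primrec (Nat.Primrec'.prim_iff₂.2 hprim)
  refine ⟨p, fun c => ?_⟩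
  have hpe : ∀ y, p.eval (pad 0 [y, Encodable.encode c]) = 0 ↔
      (Nat.Partrec.Code.evaln y c 0).isSome := by
    intro y
    refine (Eq.congr_left (hp (y ::ᵥ Encodable.encode c ::ᵥ List.Vector.nil))).trans ?_
    simp [Option.isSome_iff_ne_none]
  simp only [hpe, Option.isSome_iff_exists, Part.dom_iff_mem, Nat.Partrec.Code.evaln_complete,
    Option.mem_def]
  exact exists_comm

end PVMA.EPRReduction


namespace PVMA

open FirstOrder FirstOrder.Language

/-- The verification problem for coherent programs modulo EPR axioms is
undecidable: no computable function decides, given a finite signature, a finite set of EPR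
sentences `A`, a finite variable set, a program coherent modulo `A` and a quantifier-free
postcondition, whether the program satisfies the postcondition modulo `A`. -/
theorem verification_modulo_EPR_undecidable :
    ¬ ∃ g : ℕ → Bool, Computable g ∧
        ∀ (S : FinSig) (A : List (EPRAx S.lang)) (m : ℕ)
          (init : Fin m → (S.lang).Constants) (s : Prog S.lang (Fin m))
          (φ : Post S.lang (Fin m)),
          CoherentProg (eprTheory A) init s →
          (g (encL [S.enc, encL (A.map (encEPRAx S)),
              encVerifInput S.encF S.encR init s φ]) = true ↔
            Satisfies (eprTheory A) init s φ) := by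
  rintro ⟨g, hg, h⟩
  obtain ⟨p, hp⟩ := EPRReduction.exists_code_halting
  obtain ⟨ps, K, N, hps, hK, hfit⟩ := EPRReduction.exists_fits (EPRReduction.searchClauses p)
    [.flag, .bound, .succ, .input] 2
  have hin := (EPRReduction.primrec_input ps K N (EPRReduction.searchClauses p)).to_comp.comp
    (Computable.encode (α := Nat.Partrec.Code))
  refine ComputablePred.halting_problem 0 (ComputablePred.computable_iff.2
    ⟨_, Primrec.not.to_comp.comp (hg.comp hin), funext fun c => propext ?_⟩)
  have hc := h _ _ _ EPRReduction.initConst (EPRReduction.prog (Encodable.encode c))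
    EPRReduction.postcond (EPRReduction.coherentProg_prog hps hK hfit _)
  rw [EPRReduction.satisfies_prog_iff hps hK hfit, hp] at hc
  rw [Bool.not_eq_true', ← Bool.not_eq_true, hc, not_not]

end PVMA
end

section
/- Feasibility of a single coherent execution modulo associativity is undecidable: there is no algorithm that, given a finite first-order signature Σ containing a binary function symbol f, a finite variable set V, and an execution ρ over (Σ, V) that is coherent modulo {φ_assoc^f}, decides whether ρ is feasible modulo {φ_assoc^f}. Consequently, the verification problem for coherent programs modulo associativity axioms is undecidable. -/
namespace PVMA

/-! ### A semigroup acting on sets of monoid elements -/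

section ActMul

variable {T : Type} [Monoid T]

/-- The semigroup operation on a monoid `T` together with its subsets: a subset is moved by a
monoid element on its right to a residual, and every product ending in a subset is empty. -/
def actMul : T ⊕ Set T → T ⊕ Set T → T ⊕ Set T
  | .inl a, .inl b => .inl (a * b)
  | .inr A, .inl b => .inr {t | b * t ∈ A}
  | _, .inr _ => .inr ∅

theorem actMul_assoc (x y z : T ⊕ Set T) : actMul (actMul x y) z = actMul x (actMul y z) := by
  rcases x with x | x <;> rcases y with y | y <;> rcases z with z | z <;>
    simp [actMul, mul_assoc]

theorem foldl_actMul_inr {ι : Type} (g : ι → T) (w : List ι) (A : Set T) :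
    w.foldl (fun x i => actMul x (.inl (g i))) (.inr A) =
      .inr {t | (w.map g).prod * t ∈ A} := by
  induction w generalizing A with
  | nil => simp
  | cons i w ih =>
    rw [List.foldl_cons, actMul, ih]
    simp [mul_assoc]

end ActMul

/-! ### Stack machines in semigroups -/

section StackMachine

open Turing

variable {K Γ Λ σ : Type}

/-- Generators of the semigroup simulating a stack machine: stack symbols (`none` is the bottom
marker), control states consisting of a statement and a memory state, and an accepting symbol. -/
inductive MachineLetter (K Γ Λ σ : Type) : Type
  | sym (p : K × Option Γ)
  | ctl (q : TM2.Stmt (fun _ : K => Γ) Λ σ) (s : σ)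
  | acc

/-- The part of a stack word above the topmost bottom marker. -/
def aboveBottom : List (Option Γ) → List Γ
  | some a :: l => a :: aboveBottom l
  | _ => []

theorem aboveBottom_map_some_append (l : List Γ) (r : List (Option Γ)) :
    aboveBottom (l.map some ++ none :: r) = l := by
  induction l with
  | nil => rfl
  | cons a l ih => simp [aboveBottom, ih]

theorem some_mem_stmts {M : Λ → TM2.Stmt (fun _ : K => Γ) Λ σ} {S : Finset Λ} {l : Λ}
    (hl : l ∈ S) : some (M l) ∈ TM2.stmts M S := by
  simp only [TM2.stmts, Finset.some_mem_insertNone, Finset.mem_biUnion]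
  exact ⟨_, hl, TM2.stmts₁_self⟩

/-- The generators for control states in a set of statements. -/
def machineLetters (P : Set (TM2.Stmt (fun _ : K => Γ) Λ σ)) : Set (MachineLetter K Γ Λ σ) :=
  {x | ∀ q s, x = .ctl q s → q ∈ P}

section

variable {P : Set (TM2.Stmt (fun _ : K => Γ) Λ σ)}

theorem sym_mem_machineLetters (p : K × Option Γ) :
    (.sym p : MachineLetter K Γ Λ σ) ∈ machineLetters P := by
  intro q s h; cases h

theorem acc_mem_machineLetters : (.acc : MachineLetter K Γ Λ σ) ∈ machineLetters P := by
  intro q s h; cases h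

theorem ctl_mem_machineLetters {q : TM2.Stmt (fun _ : K => Γ) Λ σ} (hq : q ∈ P) (s : σ) :
    (.ctl q s : MachineLetter K Γ Λ σ) ∈ machineLetters P := by
  intro q' s' h; cases h; exact hq

end

variable [DecidableEq K]

/-- Termination of a stack machine started inside a statement. -/
def HaltsFrom (M : Λ → TM2.Stmt (fun _ : K => Γ) Λ σ) (q : TM2.Stmt (fun _ : K => Γ) Λ σ) (s : σ)
    (S : K → List Γ) : Prop :=
  (StateTransition.eval (TM2.step M) (TM2.stepAux q s S)).Dom

/-- The monoid element given by a single stack symbol. -/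
def symElt (p : K × Option Γ) : K → FreeMonoid (Option Γ) :=
  Pi.mulSingle p.1 (FreeMonoid.of p.2)

/-- The stacks described by a monoid element. -/
def stacksOf (t : K → FreeMonoid (Option Γ)) : K → List Γ :=
  fun k => aboveBottom (FreeMonoid.toList (t k))

/-- The interpretation of the generators in the semigroup of residuals. -/
def machineInterp (M : Λ → TM2.Stmt (fun _ : K => Γ) Λ σ) :
    MachineLetter K Γ Λ σ →
      (K → FreeMonoid (Option Γ)) ⊕ Set (K → FreeMonoid (Option Γ))
  | .sym p => .inl (symElt p)
  | .ctl q s => .inr {t | HaltsFrom M q s (stacksOf t)}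
  | .acc => .inr Set.univ

/-- A word of stack symbols represents a family of stacks. -/
def RepStacks (w : List (K × Option Γ)) (S : K → List Γ) : Prop :=
  ∀ k, (w.filter (fun p => p.1 = k)).map Prod.snd = (S k).map some ++ [none]

theorem toList_prod_symElt (w : List (K × Option Γ)) (k : K) :
    FreeMonoid.toList ((w.map symElt).prod k) =
      (w.filter (fun p => p.1 = k)).map Prod.snd := by
  induction w with
  | nil => simp
  | cons p w ih =>
    by_cases h : p.1 = k
    · subst h
      simp [symElt, ih]
    · simp [symElt, ih, h]

theorem foldl_machineInterp_ctl (M : Λ → TM2.Stmt (fun _ : K => Γ) Λ σ)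
    (q : TM2.Stmt (fun _ : K => Γ) Λ σ) (s : σ) {w : List (K × Option Γ)} {S : K → List Γ}
    (hw : RepStacks w S) (h : ¬ HaltsFrom M q s S) :
    w.foldl (fun x p => actMul x (machineInterp M (.sym p))) (machineInterp M (.ctl q s)) ≠
      machineInterp M .acc := by
  intro he
  have h1 := foldl_actMul_inr symElt w {t | HaltsFrom M q s (stacksOf t)}
  simp only [machineInterp] at he
  rw [h1] at he
  have h2 := Set.eq_univ_iff_forall.1 (Sum.inr.inj he) 1
  apply h
  have : stacksOf ((w.map symElt).prod * 1) = S := by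
    funext k
    rw [mul_one, stacksOf, toList_prod_symElt, hw k, aboveBottom_map_some_append]
  simpa only [Set.mem_ofPred_eq, this] using h2

theorem stacksOf_symElt_some_mul (k : K) (a : Γ) (t : K → FreeMonoid (Option Γ)) :
    stacksOf (symElt (k, some a) * t) = Function.update (stacksOf t) k (a :: stacksOf t k) := by
  funext j
  by_cases h : j = k
  · subst h
    simp [stacksOf, symElt, aboveBottom]
  · simp [stacksOf, symElt, h]

theorem stacksOf_symElt_none_mul (k : K) (t : K → FreeMonoid (Option Γ)) :
    stacksOf (symElt (k, none) * t) = Function.update (stacksOf t) k [] := by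
  funext j
  by_cases h : j = k
  · subst h
    simp [stacksOf, symElt, aboveBottom]
  · simp [stacksOf, symElt, h]

/-- A map into a semigroup satisfies every short relation that holds between generators in `F`
in the semigroup of residuals. -/
structure RespectsRelations (M : Λ → TM2.Stmt (fun _ : K => Γ) Λ σ)
    (F : Set (MachineLetter K Γ Λ σ)) {α : Type} (op : α → α → α)
    (μ : MachineLetter K Γ Λ σ → α) : Prop where
  one_one : ∀ a ∈ F, ∀ b ∈ F, machineInterp M a = machineInterp M b → μ a = μ b
  two_one : ∀ a ∈ F, ∀ b ∈ F, ∀ c ∈ F,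
    actMul (machineInterp M a) (machineInterp M b) = machineInterp M c → op (μ a) (μ b) = μ c
  two_two : ∀ a ∈ F, ∀ b ∈ F, ∀ c ∈ F, ∀ d ∈ F,
    actMul (machineInterp M a) (machineInterp M b) =
      actMul (machineInterp M c) (machineInterp M d) → op (μ a) (μ b) = op (μ c) (μ d)

section Completeness

variable {M : Λ → TM2.Stmt (fun _ : K => Γ) Λ σ} {P : Set (TM2.Stmt (fun _ : K => Γ) Λ σ)}
  {α : Type} {op : α → α → α} {μ : MachineLetter K Γ Λ σ → α}

theorem foldl_move_to_front (hassoc : ∀ x y z, op (op x y) z = op x (op y z))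
    (hμ : RespectsRelations M (machineLetters P) op μ) {k : K} {a : Option Γ}
    {r : List (Option Γ)} (w : List (K × Option Γ))
    (hw : (w.filter (fun p => p.1 = k)).map Prod.snd = a :: r) :
    ∃ w' : List (K × Option Γ), (w'.filter (fun p => p.1 = k)).map Prod.snd = r ∧
      (∀ j, j ≠ k → (w'.filter (fun p => p.1 = j)).map Prod.snd =
        (w.filter (fun p => p.1 = j)).map Prod.snd) ∧
      ∀ x, w.foldl (fun x p => op x (μ (.sym p))) x =
        w'.foldl (fun x p => op x (μ (.sym p))) (op x (μ (.sym (k, a)))) := by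
  induction w with
  | nil => simp at hw
  | cons p w ih =>
    by_cases h : p.1 = k
    · obtain ⟨p1, p2⟩ := p
      subst h
      simp only [decide_true, List.filter_cons_of_pos, List.map_cons, List.cons.injEq] at hw
      obtain ⟨rfl, hr⟩ := hw
      exact ⟨w, hr, fun j hj => by simp [Ne.symm hj], fun x => rfl⟩
    · have hw1 : (w.filter (fun p => p.1 = k)).map Prod.snd = a :: r := by
        simpa [h] using hw
      obtain ⟨w', h1, h2, h3⟩ := ih hw1
      refine ⟨p :: w', by simpa [h] using h1, fun j hj => ?_, fun x => ?_⟩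
      · have := h2 j hj
        by_cases hp : p.1 = j <;> simp [hp, this]
      · simp only [List.foldl_cons]
        rw [h3, hassoc, hassoc]
        congr 2
        refine hμ.two_two _ (sym_mem_machineLetters _) _ (sym_mem_machineLetters _) _
          (sym_mem_machineLetters _) _ (sym_mem_machineLetters _) ?_
        exact congrArg Sum.inl (Pi.mulSingle_commute (f := fun _ => FreeMonoid (Option Γ)) h
          (FreeMonoid.of p.2) (FreeMonoid.of a)).eq

theorem repStacks_cons_some {w : List (K × Option Γ)} {S : K → List Γ} {k : K} {a : Γ}
    (h1 : (w.filter (fun p => p.1 = k)).map Prod.snd = (S k).map some ++ [none])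
    (h2 : ∀ j, j ≠ k → (w.filter (fun p => p.1 = j)).map Prod.snd = (S j).map some ++ [none]) :
    RepStacks ((k, some a) :: w) (Function.update S k (a :: S k)) := by
  intro j
  by_cases hj : j = k
  · subst hj; simp [h1]
  · simp [hj, Ne.symm hj, h2 j hj]

theorem foldl_acc (hμ : RespectsRelations M (machineLetters P) op μ) (w : List (K × Option Γ)) :
    w.foldl (fun x p => op x (μ (.sym p))) (μ .acc) = μ .acc := by
  induction w with
  | nil => rfl
  | cons p w ih =>
    rw [List.foldl_cons, hμ.two_one _ acc_mem_machineLetters _ (sym_mem_machineLetters _) _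
      acc_mem_machineLetters, ih]
    simp [machineInterp, actMul]

/-- Every word representing the stacks of a configuration evaluates to the accepting symbol. -/
def CfgAccepted (M : Λ → TM2.Stmt (fun _ : K => Γ) Λ σ) (op : α → α → α)
    (μ : MachineLetter K Γ Λ σ → α) (S : Finset Λ) (c : TM2.Cfg (fun _ : K => Γ) Λ σ) : Prop :=
  ∀ l ∈ S, c.l = some l → ∀ w, RepStacks w c.stk →
    w.foldl (fun x p => op x (μ (.sym p))) (μ (.ctl (M l) c.var)) = μ .acc

theorem foldl_ctl_of_cfgAccepted {S : Finset Λ}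
    (hassoc : ∀ x y z, op (op x y) z = op x (op y z))
    (hμ : RespectsRelations M (machineLetters {q | some q ∈ TM2.stmts M S}) op μ)
    (q : TM2.Stmt (fun _ : K => Γ) Λ σ)
    (hq : some q ∈ TM2.stmts M S) (hS : TM2.SupportsStmt S q) (s : σ) (stk : K → List Γ)
    (hc : CfgAccepted M op μ S (TM2.stepAux q s stk)) (w : List (K × Option Γ))
    (hw : RepStacks w stk) :
    w.foldl (fun x p => op x (μ (.sym p))) (μ (.ctl q s)) = μ .acc := by
  have hctl : ∀ {q'} (s' : σ), some q' ∈ TM2.stmts M S →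
    (.ctl q' s' : MachineLetter K Γ Λ σ) ∈ machineLetters {q | some q ∈ TM2.stmts M S} :=
    fun s' h => ctl_mem_machineLetters h s'
  induction q generalizing s stk w with
  | push k f q ih =>
    have hq' : some q ∈ TM2.stmts M S := TM2.stmts_trans
      (by simp [TM2.stmts₁, TM2.stmts₁_self]) hq
    have := ih hq' hS s _ hc ((k, some (f s)) :: w) (repStacks_cons_some (hw k) fun j _ => hw j)
    rw [← this, List.foldl_cons]
    congr 1
    refine (hμ.two_one _ (hctl _ hq') _ (sym_mem_machineLetters _) _ (hctl _ hq) ?_).symm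
    simp [machineInterp, actMul, stacksOf_symElt_some_mul, HaltsFrom]
  | peek k f q ih =>
    have hq' : some q ∈ TM2.stmts M S := TM2.stmts_trans
      (by simp [TM2.stmts₁, TM2.stmts₁_self]) hq
    have hwk := hw k
    cases hk : stk k with
    | nil =>
      rw [hk] at hwk
      obtain ⟨w', h1, h2, h3⟩ := foldl_move_to_front hassoc hμ w hwk
      simp only [TM2.stepAux, hk, List.head?_nil] at hc
      rw [h3, ← ih hq' hS _ _ hc ((k, none) :: w'), List.foldl_cons]
      · congr 1
        refine hμ.two_two _ (hctl _ hq) _ (sym_mem_machineLetters _) _ (hctl _ hq') _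
          (sym_mem_machineLetters _) ?_
        simp [machineInterp, actMul, stacksOf_symElt_none_mul, HaltsFrom]
      · intro j
        by_cases hj : j = k
        · subst hj; simpa [hk] using h1
        · simp [Ne.symm hj, h2 j hj, hw j]
    | cons a r =>
      rw [hk] at hwk
      obtain ⟨w', h1, h2, h3⟩ := foldl_move_to_front hassoc hμ w hwk
      simp only [TM2.stepAux, hk, List.head?_cons] at hc
      rw [h3, ← ih hq' hS _ _ hc ((k, some a) :: w'), List.foldl_cons]
      · congr 1
        refine hμ.two_two _ (hctl _ hq) _ (sym_mem_machineLetters _) _ (hctl _ hq') _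
          (sym_mem_machineLetters _) ?_
        simp [machineInterp, actMul, stacksOf_symElt_some_mul, HaltsFrom]
      · intro j
        by_cases hj : j = k
        · subst hj; simpa [hk] using h1
        · simp [Ne.symm hj, h2 j hj, hw j]
  | pop k f q ih =>
    have hq' : some q ∈ TM2.stmts M S := TM2.stmts_trans
      (by simp [TM2.stmts₁, TM2.stmts₁_self]) hq
    have hwk := hw k
    cases hk : stk k with
    | nil =>
      rw [hk] at hwk
      obtain ⟨w', h1, h2, h3⟩ := foldl_move_to_front hassoc hμ w hwk
      simp only [TM2.stepAux, hk, List.head?_nil] at hc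
      rw [h3, ← ih hq' hS _ _ hc ((k, none) :: w'), List.foldl_cons]
      · congr 1
        refine hμ.two_two _ (hctl _ hq) _ (sym_mem_machineLetters _) _ (hctl _ hq') _
          (sym_mem_machineLetters _) ?_
        simp [machineInterp, actMul, stacksOf_symElt_none_mul, HaltsFrom]
      · intro j
        by_cases hj : j = k
        · subst hj; simpa [hk] using h1
        · simp [hj, Ne.symm hj, h2 j hj, hw j]
    | cons a r =>
      rw [hk] at hwk
      obtain ⟨w', h1, h2, h3⟩ := foldl_move_to_front hassoc hμ w hwk
      simp only [TM2.stepAux, hk, List.head?_cons, List.tail_cons] at hc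
      rw [h3, ← ih hq' hS _ _ hc w']
      · congr 1
        refine hμ.two_one _ (hctl _ hq) _ (sym_mem_machineLetters _) _ (hctl _ hq') ?_
        simp [machineInterp, actMul, stacksOf_symElt_some_mul, HaltsFrom]
      · intro j
        by_cases hj : j = k
        · subst hj; simpa using h1
        · simp [hj, h2 j hj, hw j]
  | load f q ih =>
    have hq' : some q ∈ TM2.stmts M S := TM2.stmts_trans
      (by simp [TM2.stmts₁, TM2.stmts₁_self]) hq
    rw [← ih hq' hS _ _ hc w hw]
    congr 1
    exact hμ.one_one _ (hctl _ hq) _ (hctl _ hq') (by simp [machineInterp, HaltsFrom])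
  | branch f q₁ q₂ ih₁ ih₂ =>
    have hq₁ : some q₁ ∈ TM2.stmts M S := TM2.stmts_trans
      (by simp [TM2.stmts₁, TM2.stmts₁_self]) hq
    have hq₂ : some q₂ ∈ TM2.stmts M S := TM2.stmts_trans
      (by simp [TM2.stmts₁, TM2.stmts₁_self]) hq
    cases hf : f s with
    | true =>
      simp only [TM2.stepAux, hf, cond_true] at hc
      rw [← ih₁ hq₁ hS.1 _ _ hc w hw]
      congr 1
      exact hμ.one_one _ (hctl _ hq) _ (hctl _ hq₁) (by simp [machineInterp, HaltsFrom, hf])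
    | false =>
      simp only [TM2.stepAux, hf, cond_false] at hc
      rw [← ih₂ hq₂ hS.2 _ _ hc w hw]
      congr 1
      exact hμ.one_one _ (hctl _ hq) _ (hctl _ hq₂) (by simp [machineInterp, HaltsFrom, hf])
  | goto f =>
    have hl : f s ∈ S := hS s
    have hq' : some (M (f s)) ∈ TM2.stmts M S := by
      simp only [TM2.stmts, Finset.some_mem_insertNone, Finset.mem_biUnion]
      exact ⟨_, hl, TM2.stmts₁_self⟩
    rw [← hc _ hl rfl w hw]
    congr 1
    refine hμ.one_one _ (hctl _ hq) _ (hctl _ hq') ?_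
    simp only [machineInterp, HaltsFrom, TM2.stepAux]
    congr 1
    ext t
    simp only [Set.mem_ofPred_eq]
    rw [StateTransition.reaches_eval (f := TM2.step M) (a := ⟨some (f s), s, stacksOf t⟩)
      (Relation.ReflTransGen.single rfl)]
  | halt =>
    rw [← foldl_acc hμ w]
    congr 1
    refine hμ.one_one _ (hctl _ hq) _ acc_mem_machineLetters ?_
    simp only [machineInterp, HaltsFrom, TM2.stepAux]
    congr 1
    refine Set.eq_univ_of_forall fun t => ?_
    refine Part.dom_iff_mem.2 ⟨_, StateTransition.mem_eval.2 ⟨Relation.ReflTransGen.refl, rfl⟩⟩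

theorem foldl_ctl_of_haltsFrom {S : Finset Λ} (hassoc : ∀ x y z, op (op x y) z = op x (op y z))
    (hμ : RespectsRelations M (machineLetters {q | some q ∈ TM2.stmts M S}) op μ)
    (hM : ∀ l ∈ S, TM2.SupportsStmt S (M l)) {l : Λ} (hl : l ∈ S) (s : σ) {stk : K → List Γ}
    (hh : HaltsFrom M (M l) s stk) {w : List (K × Option Γ)} (hw : RepStacks w stk) :
    w.foldl (fun x p => op x (μ (.sym p))) (μ (.ctl (M l) s)) = μ .acc := by
  obtain ⟨c', hc'⟩ := Part.dom_iff_mem.1 hh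
  obtain ⟨hr, hn⟩ := StateTransition.mem_eval.1 hc'
  have key : CfgAccepted M op μ S (TM2.stepAux (M l) s stk) := by
    generalize TM2.stepAux (M l) s stk = c at hr
    induction hr using Relation.ReflTransGen.head_induction_on with
    | refl =>
      intro l hl hcl
      obtain ⟨lo, v, T⟩ := c'
      cases hcl
      simp [TM2.step] at hn
    | @head a c hac _ ih =>
      obtain ⟨lo, v, T⟩ := a
      intro l hl hcl w hw
      cases hcl
      simp only [TM2.step, Option.mem_def, Option.some.injEq] at hac
      subst hac
      exact foldl_ctl_of_cfgAccepted hassoc hμ _ (some_mem_stmts hl) (hM l hl) v T ih w hw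
  exact foldl_ctl_of_cfgAccepted hassoc hμ _ (some_mem_stmts hl) (hM l hl) s stk key w hw

end Completeness

end StackMachine
end PVMA

namespace PVMA

open FirstOrder FirstOrder.Language

/-! ### Straight-line executions that never drop a term -/

section Retaining

variable {L : FirstOrder.Language.{0,0}} {V : Type} [DecidableEq V]

/-- Every computed term is still stored in some variable, at every moment of the execution. -/
def Retaining (init : V → L.Constants) (ρ : Exec L V) : Prop :=
  ∀ σ, σ <+: ρ → ∀ t ∈ TermsOf init σ, ∃ y, TEval init σ y = t

theorem Retaining.coherent {init : V → L.Constants} {ρ : Exec L V} (h : Retaining init ρ)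
    (A : L.Theory) : Coherent A init ρ := by
  refine ⟨fun σ x n f z hp ⟨t', ht', he⟩ => ?_, fun σ a hp _ t ht hx => ?_⟩
  · obtain ⟨y, rfl⟩ := h σ ((List.prefix_append _ _).trans hp) t' ht'
    exact ⟨y, he⟩
  · obtain ⟨y, rfl⟩ := h σ ((List.prefix_append _ _).trans hp) t ht
    exact absurd (fun M _ _ => rfl) (hx y)

theorem TEval_append_singleton (init : V → L.Constants) (ρ : Exec L V) (a : ProgLetter L V) :
    TEval init (ρ ++ [a]) = stepState (TEval init ρ) a := by
  simp [TEval]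

theorem retaining_nil (init : V → L.Constants) : Retaining init ([] : Exec L V) := by
  rintro σ hσ t ⟨τ, x, hτ, rfl⟩
  obtain rfl := List.prefix_nil.1 hσ
  obtain rfl := List.prefix_nil.1 hτ
  exact ⟨x, rfl⟩

theorem Retaining.append_singleton {init : V → L.Constants} {ρ : Exec L V}
    (h : Retaining init ρ) {a : ProgLetter L V}
    (ha : ∀ y, ∃ y', TEval init (ρ ++ [a]) y' = TEval init ρ y) : Retaining init (ρ ++ [a]) := by
  rintro σ hσ t ⟨τ, x, hτ, rfl⟩
  rcases List.prefix_concat_iff.1 hσ with rfl | hσ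
  · rcases List.prefix_concat_iff.1 hτ with rfl | hτ
    · exact ⟨x, rfl⟩
    · obtain ⟨y, hy⟩ := h ρ (List.prefix_refl _) _ ⟨τ, x, hτ, rfl⟩
      obtain ⟨y', hy'⟩ := ha y
      exact ⟨y', hy'.trans hy⟩
  · exact h σ hσ _ ⟨τ, x, hτ, rfl⟩

theorem feasibleIn_append_singleton (M : Struc L) (init : V → L.Constants) (ρ : Exec L V)
    (a : ProgLetter L V) :
    FeasibleIn M init (ρ ++ [a]) ↔
      FeasibleIn M init ρ ∧ ∀ l, litOf (TEval init ρ) a = some l → M.SatLit l := by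
  constructor
  · intro h
    exact ⟨fun σ b hp => h σ b (hp.trans (List.prefix_append _ _)), h ρ a (List.prefix_refl _)⟩
  · rintro ⟨h1, h2⟩ σ b hp
    rcases List.prefix_concat_iff.1 hp with he | hp
    · obtain ⟨rfl, rfl⟩ := List.append_singleton_inj.1 he
      exact h2
    · exact h1 σ b hp

theorem feasibleIn_nil (M : Struc L) (init : V → L.Constants) :
    FeasibleIn M init ([] : Exec L V) := by
  intro σ a hp
  simp at hp

end Retaining

section StraightLine

variable {L : FirstOrder.Language.{0,0}} {k : ℕ}

/-- The calls storing `f (x_a, x_b)`, with `(a, b) = c j`, in the variable `N + j`, for `j < n`. -/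
def callBlock (k : ℕ) (f : L.Functions 2) (N : ℕ) (c : ℕ → ℕ × ℕ) (n : ℕ) :
    Exec L (Fin (k + 1)) :=
  (List.range n).map fun j =>
    .call (Fin.ofNat (k + 1) (N + j)) f
      ![Fin.ofNat (k + 1) (c j).1, Fin.ofNat (k + 1) (c j).2]

/-- Equality assumptions between variables. -/
def eqBlock (L : FirstOrder.Language.{0,0}) (k : ℕ) (es : List (ℕ × ℕ)) : Exec L (Fin (k + 1)) :=
  es.map fun p => .assumeEq (Fin.ofNat (k + 1) p.1) (Fin.ofNat (k + 1) p.2)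

/-- A block of calls, followed by equality assumptions and one disequality assumption. -/
def straightLine (k : ℕ) (f : L.Functions 2) (N : ℕ) (c : ℕ → ℕ × ℕ) (n : ℕ)
    (es : List (ℕ × ℕ)) (d : ℕ × ℕ) : Exec L (Fin (k + 1)) :=
  callBlock k f N c n ++ eqBlock L k es ++
    [.assumeNe (Fin.ofNat (k + 1) d.1) (Fin.ofNat (k + 1) d.2)]

theorem callBlock_succ (f : L.Functions 2) (N : ℕ) (c : ℕ → ℕ × ℕ) (n : ℕ) :
    callBlock k f N c (n + 1) = callBlock k f N c n ++
      [.call (Fin.ofNat (k + 1) (N + n)) f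
        ![Fin.ofNat (k + 1) (c n).1, Fin.ofNat (k + 1) (c n).2] ] := by
  simp [callBlock, List.range_succ]

variable {init : Fin (k + 1) → L.Constants} {f : L.Functions 2} {N : ℕ} {c : ℕ → ℕ × ℕ} {n : ℕ}

theorem Fin_ofNat_ne {i j : ℕ} (hi : i < k + 1) (hj : j < k + 1) (h : i ≠ j) :
    Fin.ofNat (k + 1) i ≠ Fin.ofNat (k + 1) j := by
  intro e
  have := congrArg Fin.val e
  simp [Nat.mod_eq_of_lt hi, Nat.mod_eq_of_lt hj] at this
  exact h this

theorem callBlock_spec (hN : 0 < N) (hinit : ∀ i : Fin (k + 1), N ≤ i → init i = init 0)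
    (hc : ∀ j < n, (c j).1 < N + j ∧ (c j).2 < N + j) (hn : N + n ≤ k + 1) :
    (∀ i < k + 1, i < N ∨ N + n ≤ i →
      TEval init (callBlock k f N c n) (Fin.ofNat (k + 1) i) =
        Constants.term (init (Fin.ofNat (k + 1) i))) ∧
    (∀ j < n, TEval init (callBlock k f N c n) (Fin.ofNat (k + 1) (N + j)) =
      Term.func f fun i => TEval init (callBlock k f N c n)
        (![Fin.ofNat (k + 1) (c j).1, Fin.ofNat (k + 1) (c j).2] i)) ∧
    Retaining init (callBlock k f N c n) := by
  induction n with
  | zero => exact ⟨fun i _ _ => rfl, fun j hj => absurd hj (by omega), retaining_nil init⟩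
  | succ n ih =>
    obtain ⟨h1, h2, h3⟩ := ih (fun j hj => hc j (by omega)) (by omega)
    have hst : ∀ i < k + 1, i ≠ N + n →
        TEval init (callBlock k f N c (n + 1)) (Fin.ofNat (k + 1) i) =
          TEval init (callBlock k f N c n) (Fin.ofNat (k + 1) i) := by
      intro i hi hne
      rw [callBlock_succ, TEval_append_singleton]
      exact Function.update_of_ne (Fin_ofNat_ne hi (by omega) hne) _ _
    refine ⟨fun i hi h => ?_, fun j hj => ?_, ?_⟩
    · rw [hst i hi (by omega)]
      exact h1 i hi (by omega)
    · have hargs : (fun i => TEval init (callBlock k f N c (n + 1))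
            (![Fin.ofNat (k + 1) (c j).1, Fin.ofNat (k + 1) (c j).2] i)) =
          fun i => TEval init (callBlock k f N c n)
            (![Fin.ofNat (k + 1) (c j).1, Fin.ofNat (k + 1) (c j).2] i) := by
        have := hc j hj
        funext i
        fin_cases i
        · exact hst _ (by omega) (by omega)
        · exact hst _ (by omega) (by omega)
      rw [hargs]
      rcases Nat.lt_succ_iff_lt_or_eq.1 hj with hj' | rfl
      · rw [hst _ (by omega) (by omega), h2 j hj']
      · rw [callBlock_succ, TEval_append_singleton]
        exact Function.update_self _ _ _
    · rw [callBlock_succ]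
      refine h3.append_singleton fun y => ?_
      rw [← callBlock_succ]
      have hy : Fin.ofNat (k + 1) y.val = y := by simp
      by_cases hyn : y.val = N + n
      · refine ⟨Fin.ofNat (k + 1) 0, ?_⟩
        rw [hst 0 (by omega) (by omega), h1 0 (by omega) (by omega), ← hy,
          h1 _ y.2 (by omega), hy, hinit y (by omega)]
        rfl
      · exact ⟨y, by rw [← hy]; exact hst _ y.2 hyn⟩

theorem TEval_append_eqBlock (ρ : Exec L (Fin (k + 1))) (es : List (ℕ × ℕ)) :
    TEval init (ρ ++ eqBlock L k es) = TEval init ρ := by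
  induction es using List.reverseRecOn with
  | nil => simp [eqBlock]
  | append_singleton es p ih =>
    rw [eqBlock, List.map_append, List.map_singleton, ← List.append_assoc,
      TEval_append_singleton]
    exact ih

theorem straightLine_coherent (hN : 0 < N) (hinit : ∀ i : Fin (k + 1), N ≤ i → init i = init 0)
    (hc : ∀ j < n, (c j).1 < N + j ∧ (c j).2 < N + j) (hn : N + n ≤ k + 1)
    (es : List (ℕ × ℕ)) (d : ℕ × ℕ) (A : L.Theory) :
    Coherent A init (straightLine k f N c n es d) := by
  apply Retaining.coherent
  refine Retaining.append_singleton ?_ fun y => ⟨y, by rw [TEval_append_singleton]; rfl⟩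
  induction es using List.reverseRecOn with
  | nil => simpa [eqBlock] using (callBlock_spec hN hinit hc hn).2.2
  | append_singleton es p ih =>
    rw [eqBlock, List.map_append, List.map_singleton, ← List.append_assoc]
    exact Retaining.append_singleton ih fun y => ⟨y, by rw [TEval_append_singleton]; rfl⟩

/-- The interpretation of a binary function symbol as an operation. -/
def Struc.op2 (M : Struc L) (f : L.Functions 2) (x y : M.carrier) : M.carrier :=
  @Structure.funMap L M.carrier M.inst 2 f ![x, y]

theorem Struc.sat_phiAssoc (M : Struc L) (f : L.Functions 2) :
    M.SatTheory {phiAssoc f} ↔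
      ∀ x y z, M.op2 f (M.op2 f x y) z = M.op2 f x (M.op2 f y z) := by
  let _ := M.inst
  simp only [SatTheory, Set.mem_singleton_iff, forall_eq, Sat, Sentence.Realize, phiAssoc,
    Formula.Realize, BoundedFormula.realize_all, BoundedFormula.realize_bdEqual,
    Term.realize_functions_apply₂, op2]
  rfl

theorem Struc.evalT_func_two (M : Struc L) (f : L.Functions 2) (ts : Fin 2 → L.Term Empty) :
    M.evalT (Term.func f ts) = M.op2 f (M.evalT (ts 0)) (M.evalT (ts 1)) := by
  let _ := M.inst
  simp only [evalT, op2, Term.realize_func]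
  congr 1
  funext i
  fin_cases i <;> rfl

theorem feasibleIn_append_eqBlock (M : Struc L) (ρ : Exec L (Fin (k + 1))) (es : List (ℕ × ℕ)) :
    FeasibleIn M init (ρ ++ eqBlock L k es) ↔ FeasibleIn M init ρ ∧
      ∀ p ∈ es, M.evalT (TEval init ρ (Fin.ofNat (k + 1) p.1)) =
        M.evalT (TEval init ρ (Fin.ofNat (k + 1) p.2)) := by
  induction es using List.reverseRecOn with
  | nil => simp [eqBlock]
  | append_singleton es p ih =>
    have : ρ ++ eqBlock L k (es ++ [p]) = (ρ ++ eqBlock L k es) ++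
        [.assumeEq (Fin.ofNat (k + 1) p.1) (Fin.ofNat (k + 1) p.2)] := by
      simp [eqBlock]
    rw [this, feasibleIn_append_singleton, ih, TEval_append_eqBlock]
    simp only [litOf, Option.some.injEq, forall_eq', Struc.SatLit, List.forall_mem_append,
      List.mem_singleton, forall_eq, and_assoc]

theorem feasibleIn_callBlock (M : Struc L) : FeasibleIn M init (callBlock k f N c n) := by
  induction n with
  | zero => exact feasibleIn_nil M init
  | succ n ih =>
    rw [callBlock_succ, feasibleIn_append_singleton]
    exact ⟨ih, fun l h => by simp [litOf] at h⟩

theorem straightLine_feasibleIn_iff (hN : 0 < N)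
    (hinit : ∀ i : Fin (k + 1), N ≤ i → init i = init 0)
    (hc : ∀ j < n, (c j).1 < N + j ∧ (c j).2 < N + j) (hn : N + n ≤ k + 1)
    (es : List (ℕ × ℕ)) (d : ℕ × ℕ) (M : Struc L) :
    ∃ v : ℕ → M.carrier,
      (∀ i < N, v i = M.evalT (Constants.term (init (Fin.ofNat (k + 1) i)))) ∧
      (∀ j < n, v (N + j) = M.op2 f (v (c j).1) (v (c j).2)) ∧
      (FeasibleIn M init (straightLine k f N c n es d) ↔
        (∀ p ∈ es, v p.1 = v p.2) ∧ v d.1 ≠ v d.2) := by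
  obtain ⟨h1, h2, -⟩ := callBlock_spec (f := f) hN hinit hc hn
  refine ⟨fun i => M.evalT (TEval init (callBlock k f N c n) (Fin.ofNat (k + 1) i)),
    fun i hi => congrArg M.evalT (h1 i (by omega) (Or.inl hi)), fun j hj => ?_, ?_⟩
  · dsimp only
    rw [h2 j hj, Struc.evalT_func_two]
    rfl
  · rw [straightLine, feasibleIn_append_singleton, feasibleIn_append_eqBlock,
      TEval_append_eqBlock]
    simp [feasibleIn_callBlock, litOf, Struc.SatLit]

/-! ### Straight-line programs -/

/-- The straight-line program performing the letters of an execution. -/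
def progOf (f : L.Functions 2) (N : ℕ) (k : ℕ) (c : ℕ → ℕ × ℕ) (n : ℕ)
    (es : List (ℕ × ℕ)) (d : ℕ × ℕ) : Prog L (Fin (k + 1)) :=
  ((List.range n).map fun j => Prog.call (Fin.ofNat (k + 1) (N + j)) f
      ![Fin.ofNat (k + 1) (c j).1, Fin.ofNat (k + 1) (c j).2]).foldr Prog.seq
    ((es.map fun p => Prog.passume
      (.eq (Fin.ofNat (k + 1) p.1) (Fin.ofNat (k + 1) p.2))).foldr Prog.seq
      (Prog.passume (.ne (Fin.ofNat (k + 1) d.1) (Fin.ofNat (k + 1) d.2))))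

theorem execSet_foldr_seq {V ι : Type} (l : List ι) (g : ι → Prog L V) (h : ι → ProgLetter L V)
    (hg : ∀ i, ExecSet (g i) = {[h i]}) (p : Prog L V) (ρ : Exec L V) (hp : ExecSet p = {ρ}) :
    ExecSet ((l.map g).foldr Prog.seq p) = {l.map h ++ ρ} := by
  induction l with
  | nil => simpa using hp
  | cons i l ih =>
    ext τ
    simp [ExecSet, hg, ih]

theorem execSet_progOf (es : List (ℕ × ℕ)) (d : ℕ × ℕ) :
    ExecSet (progOf f N k c n es d) = {straightLine k f N c n es d} := by
  rw [straightLine, List.append_assoc]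
  refine execSet_foldr_seq _ _ _ (fun _ => rfl) _ _ ?_
  exact execSet_foldr_seq _ _ _ (fun _ => rfl) _ _ rfl

theorem satisfies_iff_not_feasibleModulo {V : Type} [DecidableEq V] (A : L.Theory)
    (init : V → L.Constants) (s : Prog L V) (ρ : Exec L V) (hs : ExecSet s = {ρ}) (x : V) :
    Satisfies A init s (.pnot (.eq x x)) ↔ ¬ FeasibleModulo A init ρ := by
  simp [Satisfies, hs, Post.Holds, FeasibleModulo]

end StraightLine

end PVMA

namespace PVMA

open FirstOrder FirstOrder.Language

/-! ### Encodings of straight-line executions -/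

section Encoding

/-- The signature with one binary function symbol and `N` constants. -/
abbrev assocSig (N : ℕ) : FinSig := ⟨2 :: List.replicate N 0, []⟩

/-- The binary function symbol of `assocSig N`. -/
def assocFun (N : ℕ) : (assocSig N).lang.Functions 2 := ⟨0, by simp⟩

/-- The `i`-th constant of `assocSig N`. -/
def assocConst {N : ℕ} (i : Fin N) : (assocSig N).lang.Constants := ⟨i, by simp⟩

/-- The initial assignment sending the `i`-th variable to the `i`-th constant if there is one,
and to the first constant otherwise. -/
def assocInit {N : ℕ} (hN : 0 < N) (k : ℕ) (i : Fin (k + 1)) : (assocSig N).lang.Constants :=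
  assocConst ⟨if i.val < N then i else 0, by split <;> omega⟩

/-- The list encoded by the initial assignment `assocInit`. -/
theorem encInit_assocInit {N : ℕ} (hN : 0 < N) (k : ℕ) :
    encInit (assocSig N).encF (assocInit hN k) =
      encL ((List.range (k + 1)).map fun i => encL [0, if i < N then i else 0]) := by
  rw [encInit, List.ofFn_eq_map, ← List.map_coe_finRange_eq_range, List.map_map]
  rfl

theorem encExec_straightLine {L : FirstOrder.Language.{0,0}} (encF : (Σ n, L.Functions n) → ℕ)
    (encR : (Σ n, L.Relations n) → ℕ) (k : ℕ) (f : L.Functions 2) (N : ℕ) (c : ℕ → ℕ × ℕ) (n : ℕ)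
    (es : List (ℕ × ℕ)) (d : ℕ × ℕ) :
    encExec encF encR (straightLine k f N c n es d) =
      encL (((List.range n).map fun j => encL [1, (N + j) % (k + 1), encF ⟨2, f⟩,
          encL [(c j).1 % (k + 1), (c j).2 % (k + 1)] ]) ++
        (es.map fun p => encL [2, p.1 % (k + 1), p.2 % (k + 1)]) ++
        [encL [3, d.1 % (k + 1), d.2 % (k + 1)] ]) := by
  simp [encExec, straightLine, callBlock, eqBlock, encLetter, Function.comp_def]

theorem encProg_foldr_seq {L : FirstOrder.Language.{0,0}} (encF : (Σ n, L.Functions n) → ℕ)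
    (encR : (Σ n, L.Relations n) → ℕ) {m : ℕ} (l : List (Prog L (Fin m))) (p : Prog L (Fin m)) :
    encProg encF encR (l.foldr Prog.seq p) =
      (l.map (encProg encF encR)).foldr (fun a b => encL [4, a, b]) (encProg encF encR p) := by
  induction l with
  | nil => rfl
  | cons a l ih => simp [encProg, ih]

theorem encProg_progOf {L : FirstOrder.Language.{0,0}} (encF : (Σ n, L.Functions n) → ℕ)
    (encR : (Σ n, L.Relations n) → ℕ) (k : ℕ) (f : L.Functions 2) (N : ℕ) (c : ℕ → ℕ × ℕ) (n : ℕ)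
    (es : List (ℕ × ℕ)) (d : ℕ × ℕ) :
    encProg encF encR (progOf f N k c n es d) =
      (((List.range n).map fun j => encL [2, (N + j) % (k + 1), encF ⟨2, f⟩,
          encL [(c j).1 % (k + 1), (c j).2 % (k + 1)] ]) ++
        (es.map fun p => encL [3, encL [0, p.1 % (k + 1), p.2 % (k + 1)] ])).foldr
        (fun a b => encL [4, a, b]) (encL [3, encL [1, d.1 % (k + 1), d.2 % (k + 1)] ]) := by
  simp [progOf, encProg_foldr_seq, encProg, encCond, Function.comp_def]

theorem primrec_encL : Primrec encL := Primrec.encode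

variable {α : Type} [Primcodable α]

theorem primrec_encL_two {a b : α → ℕ} (ha : Primrec a) (hb : Primrec b) :
    Primrec fun x => encL [a x, b x] :=
  primrec_encL.comp (Primrec.list_cons.comp ha (Primrec.list_cons.comp hb (Primrec.const [])))

theorem primrec_encL_three {a b c : α → ℕ} (ha : Primrec a) (hb : Primrec b) (hc : Primrec c) :
    Primrec fun x => encL [a x, b x, c x] :=
  primrec_encL.comp (Primrec.list_cons.comp ha (Primrec.list_cons.comp hb
    (Primrec.list_cons.comp hc (Primrec.const []))))

theorem primrec_encL_four {a b c d : α → ℕ} (ha : Primrec a) (hb : Primrec b) (hc : Primrec c)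
    (hd : Primrec d) : Primrec fun x => encL [a x, b x, c x, d x] :=
  primrec_encL.comp (Primrec.list_cons.comp ha (Primrec.list_cons.comp hb
    (Primrec.list_cons.comp hc (Primrec.list_cons.comp hd (Primrec.const [])))))

theorem primrec_mod_succ {a k : α → ℕ} (ha : Primrec a) (hk : Primrec k) :
    Primrec fun x => a x % (k x + 1) :=
  Primrec.nat_mod.comp ha (Primrec.succ.comp hk)

variable {k n : ℕ → ℕ} {c : ℕ → ℕ → ℕ × ℕ} {d : ℕ → ℕ × ℕ}

theorem primrec_encInit_assocInit {N : ℕ} (hN : 0 < N) (hk : Primrec k) :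
    Primrec fun x => encInit (assocSig N).encF (assocInit hN (k x)) := by
  simp only [encInit_assocInit]
  refine primrec_encL.comp (Primrec.list_map (Primrec.list_range.comp (Primrec.succ.comp hk)) ?_)
  exact primrec_encL_two (Primrec.const 0) (Primrec.ite
    (Primrec.nat_lt.comp Primrec.snd (Primrec.const N)) Primrec.snd (Primrec.const 0))

theorem primrec_encoded_calls (t F N : ℕ) (hk : Primrec k) (hn : Primrec n) (hc : Primrec₂ c) :
    Primrec fun x => (List.range (n x)).map fun j => encL [t, (N + j) % (k x + 1), F,
      encL [(c x j).1 % (k x + 1), (c x j).2 % (k x + 1)] ] := by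
  have hk' : Primrec fun p : ℕ × ℕ => k p.1 := hk.comp Primrec.fst
  have hc' : Primrec fun p : ℕ × ℕ => c p.1 p.2 := hc
  refine Primrec.list_map (Primrec.list_range.comp hn) ?_
  exact primrec_encL_four (Primrec.const t)
    (primrec_mod_succ (Primrec.nat_add.comp (Primrec.const N) Primrec.snd) hk')
    (Primrec.const F)
    (primrec_encL_two (primrec_mod_succ (Primrec.fst.comp hc') hk')
      (primrec_mod_succ (Primrec.snd.comp hc') hk'))

theorem primrec_encExec_straightLine {L : FirstOrder.Language.{0,0}}
    (encF : (Σ n, L.Functions n) → ℕ) (encR : (Σ n, L.Relations n) → ℕ) (f : L.Functions 2)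
    (N : ℕ) (es : List (ℕ × ℕ)) (hk : Primrec k) (hn : Primrec n) (hc : Primrec₂ c)
    (hd : Primrec d) :
    Primrec fun x => encExec encF encR (straightLine (k x) f N (c x) (n x) es (d x)) := by
  simp only [encExec_straightLine]
  have hk' : Primrec fun p : ℕ × (ℕ × ℕ) => k p.1 := hk.comp Primrec.fst
  refine primrec_encL.comp (Primrec.list_append.comp (Primrec.list_append.comp
    (primrec_encoded_calls 1 _ N hk hn hc) (Primrec.list_map (Primrec.const es) ?_))
    (Primrec.list_cons.comp ?_ (Primrec.const [])))
  · exact primrec_encL_three (Primrec.const 2)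
      (primrec_mod_succ (Primrec.fst.comp Primrec.snd) hk')
      (primrec_mod_succ (Primrec.snd.comp Primrec.snd) hk')
  · exact primrec_encL_three (Primrec.const 3) (primrec_mod_succ (Primrec.fst.comp hd) hk)
      (primrec_mod_succ (Primrec.snd.comp hd) hk)

theorem primrec_encProg_progOf {L : FirstOrder.Language.{0,0}}
    (encF : (Σ n, L.Functions n) → ℕ) (encR : (Σ n, L.Relations n) → ℕ) (f : L.Functions 2)
    (N : ℕ) (es : List (ℕ × ℕ)) (hk : Primrec k) (hn : Primrec n) (hc : Primrec₂ c)
    (hd : Primrec d) :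
    Primrec fun x => encProg encF encR (progOf f N (k x) (c x) (n x) es (d x)) := by
  simp only [encProg_progOf]
  have hk' : Primrec fun p : ℕ × (ℕ × ℕ) => k p.1 := hk.comp Primrec.fst
  refine Primrec.list_foldr (h := fun _ (p : ℕ × ℕ) => encL [4, p.1, p.2])
    (Primrec.list_append.comp (primrec_encoded_calls 2 _ N hk hn hc)
      (Primrec.list_map (Primrec.const es) ?_)) ?_ ?_
  · exact primrec_encL_two (Primrec.const 3) (primrec_encL_three (Primrec.const 0)
      (primrec_mod_succ (Primrec.fst.comp Primrec.snd) hk')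
      (primrec_mod_succ (Primrec.snd.comp Primrec.snd) hk'))
  · exact primrec_encL_two (Primrec.const 3) (primrec_encL_three (Primrec.const 1)
      (primrec_mod_succ (Primrec.fst.comp hd) hk) (primrec_mod_succ (Primrec.snd.comp hd) hk))
  · exact primrec_encL_three (Primrec.const 4) (Primrec.fst.comp Primrec.snd)
      (Primrec.snd.comp Primrec.snd)

end Encoding

theorem computablePred_of_reduction {p : ℕ → Prop} {g : ℕ → Bool} {h : ℕ → ℕ}
    (hg : Computable g) (hh : Primrec h) (H : ∀ x, g (h x) = true ↔ p x) : ComputablePred p :=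
  ComputablePred.computable_iff.2 ⟨fun x => g (h x), hg.comp hh.to_comp, funext fun x =>
    propext (H x).symm⟩

/-- A family of straight-line executions, primitive recursive in its index, whose feasibility
modulo associativity is not a computable predicate of that index. -/
structure HardFamily (N : ℕ) where
  hN : 0 < N
  k : ℕ → ℕ
  n : ℕ → ℕ
  c : ℕ → ℕ → ℕ × ℕ
  es : List (ℕ × ℕ)
  d : ℕ → ℕ × ℕ
  hk : Primrec k
  hn : Primrec n
  hc : Primrec₂ c
  hd : Primrec d
  c_lt : ∀ x, ∀ j < n x, (c x j).1 < N + j ∧ (c x j).2 < N + j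
  n_le : ∀ x, N + n x ≤ k x + 1
  hard : ¬ ComputablePred fun x => FeasibleModulo {phiAssoc (assocFun N)} (assocInit hN (k x))
    (straightLine (k x) (assocFun N) N (c x) (n x) es (d x))

theorem assocInit_of_le {N k : ℕ} (hN : 0 < N) (i : Fin (k + 1)) (hi : N ≤ i) :
    assocInit hN k i = assocInit hN k 0 := by
  refine congrArg assocConst (Fin.ext ?_)
  simp only [hi.not_gt, if_false]
  split_ifs <;> rfl

theorem HardFamily.coherent {N : ℕ} (H : HardFamily N) (x : ℕ)
    (A : (assocSig N).lang.Theory) : Coherent A (assocInit H.hN (H.k x))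
      (straightLine (H.k x) (assocFun N) N (H.c x) (H.n x) H.es (H.d x)) :=
  straightLine_coherent H.hN (assocInit_of_le H.hN) (H.c_lt x) (H.n_le x) _ _ _

theorem HardFamily.not_decidable_feasible {N : ℕ} (H : HardFamily N) :
    ¬ ∃ g : ℕ → Bool, Computable g ∧
        ∀ (S : FinSig) (f : (S.lang).Functions 2) (m : ℕ)
          (init : Fin m → (S.lang).Constants) (ρ : Exec S.lang (Fin m)),
          Coherent ({phiAssoc f} : (S.lang).Theory) init ρ →
          (g (encL [S.enc, f.val, m, encInit S.encF init, encExec S.encF S.encR ρ]) = true ↔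
            FeasibleModulo ({phiAssoc f} : (S.lang).Theory) init ρ) := by
  rintro ⟨g, hg, h⟩
  refine H.hard (computablePred_of_reduction hg ?_ fun x => h _ _ _ _ _ (H.coherent x _))
  exact primrec_encL.comp (Primrec.list_cons.comp (Primrec.const _) (Primrec.list_cons.comp
    (Primrec.const _) (Primrec.list_cons.comp (Primrec.succ.comp H.hk) (Primrec.list_cons.comp
    (primrec_encInit_assocInit H.hN H.hk) (Primrec.list_cons.comp
    (primrec_encExec_straightLine _ _ _ N H.es H.hk H.hn H.hc H.hd) (Primrec.const []))))))

theorem HardFamily.not_decidable_satisfies {N : ℕ} (H : HardFamily N) :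
    ¬ ∃ g : ℕ → Bool, Computable g ∧
        ∀ (S : FinSig) (f : (S.lang).Functions 2) (m : ℕ)
          (init : Fin m → (S.lang).Constants) (s : Prog S.lang (Fin m))
          (φ : Post S.lang (Fin m)),
          CoherentProg ({phiAssoc f} : (S.lang).Theory) init s →
          (g (encL [S.enc, f.val, encVerifInput S.encF S.encR init s φ]) = true ↔
            Satisfies ({phiAssoc f} : (S.lang).Theory) init s φ) := by
  rintro ⟨g, hg, h⟩
  refine H.hard (.of_eq (p := fun x => ¬ Satisfies {phiAssoc (assocFun N)}
    (assocInit H.hN (H.k x)) (progOf (assocFun N) N (H.k x) (H.c x) (H.n x) H.es (H.d x))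
    (.pnot (.eq 0 0))) (ComputablePred.not ?_) fun x => ?_)
  · refine computablePred_of_reduction hg ?_ fun x => h _ _ _ _ _ _ fun ρ hρ => ?_
    · refine primrec_encL_three (Primrec.const _) (Primrec.const _) (primrec_encL_four
        (Primrec.succ.comp H.hk) (primrec_encInit_assocInit H.hN H.hk)
        (primrec_encProg_progOf _ _ _ N H.es H.hk H.hn H.hc H.hd) ((Primrec.const (encL [3, encL [0, 0, 0] ])).of_eq fun x => by simp [encPost]))
    · rw [execSet_progOf, Set.mem_singleton_iff] at hρ
      rw [hρ]
      exact H.coherent x _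
  · rw [satisfies_iff_not_feasibleModulo _ _ _ _ (execSet_progOf _ _), not_not]

end PVMA

namespace PVMA

open FirstOrder FirstOrder.Language

/-! ### Computing products of generators by straight-line code -/

section ChainCalls

/-- Operands of the calls computing first all products of two of the `N` first values, and then
the left-to-right product of the values with indices `q` and `w`. -/
def chainCalls (N q : ℕ) (w : List ℕ) (j : ℕ) : ℕ × ℕ :=
  if j < N * N then (j / N, j % N)
  else (if j = N * N then q else N + j - 1, w.getD (j - N * N) 0)

theorem chainCalls_lt {N q : ℕ} {w : List ℕ} (hN : 0 < N) (hq : q < N) (hw : ∀ a ∈ w, a < N)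
    (j : ℕ) : (chainCalls N q w j).1 < N + j ∧ (chainCalls N q w j).2 < N + j := by
  have hget : w.getD (j - N * N) 0 < N := by
    rw [List.getD_eq_getElem?_getD]
    cases h : w[j - N * N]? with
    | none => exact hN
    | some a => exact hw a (List.mem_of_getElem? h)
  rw [chainCalls]
  split_ifs with h1 h2
  · have := Nat.div_lt_of_lt_mul h1
    have := Nat.mod_lt j hN
    dsimp only
    omega
  · dsimp only
    omega
  · have : 0 < N * N := Nat.mul_pos hN hN
    dsimp only
    omega

variable {α : Type} {op : α → α → α} {v : ℕ → α} {N q : ℕ} {w : List ℕ}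

theorem chainCalls_pair
    (hv : ∀ j < N * N + w.length,
      v (N + j) = op (v (chainCalls N q w j).1) (v (chainCalls N q w j).2))
    {a b : ℕ} (ha : a < N) (hb : b < N) : v (N + (a * N + b)) = op (v a) (v b) := by
  have h : a * N + b < N * N := by nlinarith
  have hN : 0 < N := by omega
  rw [hv _ (by omega), chainCalls, if_pos h]
  simp only [add_comm (a * N) b, Nat.add_mul_div_right _ _ hN, Nat.div_eq_of_lt hb, zero_add,
    Nat.add_mul_mod_self_right, Nat.mod_eq_of_lt hb]

theorem chainCalls_foldl
    (hv : ∀ j < N * N + w.length,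
      v (N + j) = op (v (chainCalls N q w j).1) (v (chainCalls N q w j).2)) :
    ∀ i < w.length, v (N + (N * N + i)) =
      (w.take (i + 1)).foldl (fun x a => op x (v a)) (v q) := by
  intro i
  induction i with
  | zero =>
    intro hi
    rw [hv _ (by omega), chainCalls, if_neg (by omega)]
    cases w with
    | nil => simp at hi
    | cons a w => simp
  | succ i ih =>
    intro hi
    rw [hv _ (by omega), chainCalls, if_neg (by omega), if_neg (by omega),
      List.take_succ_eq_append_getElem hi, List.foldl_append, ← ih (by omega)]
    have : N + (N * N + (i + 1)) - 1 = N + (N * N + i) := by omega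
    simp [this, hi]

theorem chainCalls_last
    (hv : ∀ j < N * N + w.length,
      v (N + j) = op (v (chainCalls N q w j).1) (v (chainCalls N q w j).2)) (hw : w ≠ []) :
    v (N + N * N + w.length - 1) = w.foldl (fun x a => op x (v a)) (v q) := by
  have hl := List.length_pos_iff.2 hw
  have := chainCalls_foldl hv (w.length - 1) (by omega)
  rw [Nat.sub_add_cancel hl, List.take_length] at this
  rw [← this]
  congr 1
  omega

end ChainCalls

section Simulation

open Turing

variable {K Γ Λ σ : Type}

open Classical in
/-- The position of a generator in a list. -/
noncomputable def letterIdx (gs : List (MachineLetter K Γ Λ σ)) (x : MachineLetter K Γ Λ σ) : ℕ :=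
  gs.idxOf x

variable {gs : List (MachineLetter K Γ Λ σ)}

theorem letterIdx_lt {x : MachineLetter K Γ Λ σ} (hx : x ∈ gs) :
    letterIdx gs x < gs.length := by
  classical
  exact List.idxOf_lt_length_iff.2 hx

theorem getD_letterIdx {x : MachineLetter K Γ Λ σ} (hx : x ∈ gs) :
    gs.getD (letterIdx gs x) .acc = x := by
  classical
  have := letterIdx_lt hx
  simp [this]
  exact List.getElem_idxOf _

variable [DecidableEq K]

/-- The interpretations of the generators in a list, followed by those of their products. -/
noncomputable def interpTable (M : Λ → TM2.Stmt (fun _ : K => Γ) Λ σ)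
    (gs : List (MachineLetter K Γ Λ σ)) (p : ℕ) :
    (K → FreeMonoid (Option Γ)) ⊕ Set (K → FreeMonoid (Option Γ)) :=
  let ν i := machineInterp M (gs.getD i .acc)
  if p < gs.length then ν p
  else actMul (ν ((p - gs.length) / gs.length)) (ν ((p - gs.length) % gs.length))

open Classical in
/-- All pairs of equal entries of the table of interpretations. -/
noncomputable def tableEqs (M : Λ → TM2.Stmt (fun _ : K => Γ) Λ σ)
    (gs : List (MachineLetter K Γ Λ σ)) : List (ℕ × ℕ) :=
  (List.range (gs.length + gs.length * gs.length) ×ˢ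
    List.range (gs.length + gs.length * gs.length)).filter
      fun p => interpTable M gs p.1 = interpTable M gs p.2

variable {M : Λ → TM2.Stmt (fun _ : K => Γ) Λ σ}

theorem mem_tableEqs {p : ℕ × ℕ} : p ∈ tableEqs M gs ↔
    (p.1 < gs.length + gs.length * gs.length ∧ p.2 < gs.length + gs.length * gs.length) ∧
      interpTable M gs p.1 = interpTable M gs p.2 := by
  obtain ⟨a, b⟩ := p
  simp [tableEqs]

theorem interpTable_letterIdx {x : MachineLetter K Γ Λ σ} (hx : x ∈ gs) :
    interpTable M gs (letterIdx gs x) = machineInterp M x := by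
  simp only [interpTable, if_pos (letterIdx_lt hx), getD_letterIdx hx]

theorem interpTable_pair {a b : ℕ} (ha : a < gs.length) (hb : b < gs.length) :
    interpTable M gs (gs.length + (a * gs.length + b)) =
      actMul (interpTable M gs a) (interpTable M gs b) := by
  have hN : 0 < gs.length := by omega
  simp only [interpTable, ha, hb, if_true]
  rw [if_neg (by omega), Nat.add_sub_cancel_left, add_comm (a * gs.length) b,
    Nat.add_mul_div_right _ _ hN, Nat.div_eq_of_lt hb, zero_add,
    Nat.add_mul_mod_self_right, Nat.mod_eq_of_lt hb]

theorem add_mul_add_lt {N a b : ℕ} (ha : a < N) (hb : b < N) :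
    N + (a * N + b) < N + N * N := by nlinarith

/-- The structure interpreting the binary symbol as the product in the semigroup of residuals,
and the constants as generators. -/
noncomputable def residualStruc (M : Λ → TM2.Stmt (fun _ : K => Γ) Λ σ)
    (gs : List (MachineLetter K Γ Λ σ)) : Struc (assocSig gs.length).lang where
  carrier := (K → FreeMonoid (Option Γ)) ⊕ Set (K → FreeMonoid (Option Γ))
  inst :=
    { funMap := fun {n} =>
        match n with
        | 0 => fun c _ => interpTable M gs c.val
        | 2 => fun _ x => actMul (x 0) (x 1)
        | _ => fun _ _ => .inr ∅
      RelMap := fun _ _ => False }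
  nonempty := ⟨.inr ∅⟩

theorem residualStruc_sat : (residualStruc M gs).SatTheory {phiAssoc (assocFun gs.length)} :=
  (Struc.sat_phiAssoc _ _).2 actMul_assoc

theorem residualStruc_evalT_const {i : ℕ} (hN : 0 < gs.length) (k : ℕ) (hi : i < gs.length)
    (hk : i < k + 1) :
    (residualStruc M gs).evalT (Constants.term (assocInit hN k (Fin.ofNat (k + 1) i))) =
      interpTable M gs i := by
  have h : (assocInit hN k (Fin.ofNat (k + 1) i)).val = i := by
    simp [assocInit, assocConst, Nat.mod_eq_of_lt hk, hi]
  exact congrArg (interpTable M gs) h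

theorem respectsRelations_of_tableEqs {α : Type} {op : α → α → α} {v : ℕ → α}
    {F : Set (MachineLetter K Γ Λ σ)} (hF : ∀ x ∈ F, x ∈ gs)
    (hpair : ∀ a < gs.length, ∀ b < gs.length,
      v (gs.length + (a * gs.length + b)) = op (v a) (v b))
    (heq : ∀ p ∈ tableEqs M gs, v p.1 = v p.2) :
    RespectsRelations M F op fun x => v (letterIdx gs x) := by
  have hlt : ∀ x ∈ F, letterIdx gs x < gs.length := fun x hx => letterIdx_lt (hF x hx)
  refine ⟨fun a ha b hb h => ?_, fun a ha b hb c hc h => ?_, fun a ha b hb c hc d hd h => ?_⟩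
  · refine heq (letterIdx gs a, letterIdx gs b) (mem_tableEqs.2 ⟨⟨Nat.lt_add_right _ (hlt a ha),
      Nat.lt_add_right _ (hlt b hb)⟩, ?_⟩)
    rwa [interpTable_letterIdx (hF a ha), interpTable_letterIdx (hF b hb)]
  · rw [← hpair _ (hlt a ha) _ (hlt b hb)]
    refine heq (_, letterIdx gs c) (mem_tableEqs.2 ⟨⟨add_mul_add_lt (hlt a ha) (hlt b hb),
      Nat.lt_add_right _ (hlt c hc)⟩, ?_⟩)
    rwa [interpTable_pair (hlt a ha) (hlt b hb), interpTable_letterIdx (hF a ha),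
      interpTable_letterIdx (hF b hb), interpTable_letterIdx (hF c hc)]
  · rw [← hpair _ (hlt a ha) _ (hlt b hb), ← hpair _ (hlt c hc) _ (hlt d hd)]
    refine heq (_, _) (mem_tableEqs.2 ⟨⟨add_mul_add_lt (hlt a ha) (hlt b hb),
      add_mul_add_lt (hlt c hc) (hlt d hd)⟩, ?_⟩)
    rwa [interpTable_pair (hlt a ha) (hlt b hb), interpTable_pair (hlt c hc) (hlt d hd),
      interpTable_letterIdx (hF a ha), interpTable_letterIdx (hF b hb),
      interpTable_letterIdx (hF c hc), interpTable_letterIdx (hF d hd)]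

theorem feasibleModulo_iff_not_haltsFrom {S : Finset Λ}
    (hgs : ∀ x ∈ machineLetters {q | some q ∈ TM2.stmts M S}, x ∈ gs)
    (hN : 0 < gs.length) (hM : ∀ l ∈ S, TM2.SupportsStmt S (M l)) {l : Λ} (hl : l ∈ S) (s : σ)
    {stk : K → List Γ} {w : List (K × Option Γ)} (hw : RepStacks w stk) (hw0 : w ≠ [])
    {k : ℕ} (hk : gs.length + (gs.length * gs.length + w.length) ≤ k + 1) :
    FeasibleModulo {phiAssoc (assocFun gs.length)} (assocInit hN k)
      (straightLine k (assocFun gs.length) gs.length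
        (chainCalls gs.length (letterIdx gs (.ctl (M l) s))
          (w.map fun p => letterIdx gs (.sym p)))
        (gs.length * gs.length + w.length) (tableEqs M gs)
        (gs.length + gs.length * gs.length + w.length - 1, letterIdx gs .acc)) ↔
      ¬ HaltsFrom M (M l) s stk := by
  have hsym : ∀ p, (.sym p : MachineLetter K Γ Λ σ) ∈ gs := fun p =>
    hgs _ (sym_mem_machineLetters p)
  have hacc : (.acc : MachineLetter K Γ Λ σ) ∈ gs := hgs _ acc_mem_machineLetters
  have hctl : (.ctl (M l) s : MachineLetter K Γ Λ σ) ∈ gs := 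
    hgs _ (ctl_mem_machineLetters (some_mem_stmts hl) s)
  have hlen : (w.map fun p => letterIdx gs (.sym p)).length = w.length := List.length_map _
  have hc := chainCalls_lt (w := w.map fun p => letterIdx gs (.sym p)) hN (letterIdx_lt hctl)
    fun a ha => by
      obtain ⟨p, -, rfl⟩ := List.mem_map.1 ha
      exact letterIdx_lt (hsym p)
  have spec := straightLine_feasibleIn_iff (f := assocFun gs.length) hN (assocInit_of_le hN)
    (fun j (_ : j < gs.length * gs.length + w.length) => hc j) hk (tableEqs M gs)
    (gs.length + gs.length * gs.length + w.length - 1, letterIdx gs .acc)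
  constructor
  · rintro ⟨A, hA, hf⟩ hh
    obtain ⟨v, -, hv, hiff⟩ := spec A
    obtain ⟨heq, hne⟩ := hiff.1 hf
    rw [← hlen] at hv hne
    refine hne ?_
    dsimp only
    rw [chainCalls_last hv (by simpa using hw0), List.foldl_map]
    exact foldl_ctl_of_haltsFrom (μ := fun x => v (letterIdx gs x))
      ((Struc.sat_phiAssoc _ _).1 hA) (respectsRelations_of_tableEqs hgs
        (fun a ha b hb => chainCalls_pair hv ha hb) heq) hM hl s hh hw
  · intro hh
    refine ⟨residualStruc M gs, residualStruc_sat, ?_⟩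
    obtain ⟨v, hv0, hv, hiff⟩ := spec (residualStruc M gs)
    rw [← hlen] at hv
    have hletter : ∀ i < gs.length, v i = interpTable M gs i := fun i hi =>
      (hv0 i hi).trans (residualStruc_evalT_const hN k hi (by omega))
    have htable : ∀ p < gs.length + gs.length * gs.length, v p = interpTable M gs p := by
      intro p hp
      by_cases h : p < gs.length
      · exact hletter p h
      · obtain ⟨a, b, ha, hb, rfl⟩ : ∃ a b, a < gs.length ∧ b < gs.length ∧
            p = gs.length + (a * gs.length + b) := by
          refine ⟨(p - gs.length) / gs.length, (p - gs.length) % gs.length,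
            Nat.div_lt_of_lt_mul (by omega), Nat.mod_lt _ hN, ?_⟩
          have := Nat.div_add_mod' (p - gs.length) gs.length
          omega
        rw [chainCalls_pair hv ha hb, interpTable_pair ha hb, hletter a ha, hletter b hb]
        rfl
    have hinterp : ∀ x ∈ gs, v (letterIdx gs x) = machineInterp M x := fun x hx => by
      rw [hletter _ (letterIdx_lt hx), interpTable_letterIdx hx]
    refine hiff.2 ⟨fun p hp => ?_, ?_⟩
    · obtain ⟨⟨h1, h2⟩, h⟩ := mem_tableEqs.1 hp
      rw [htable _ h1, htable _ h2, h]
    · dsimp only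
      rw [← hlen, chainCalls_last hv (by simpa using hw0), List.foldl_map, hinterp _ hctl,
        hinterp _ hacc]
      simp only [hinterp _ (hsym _)]
      exact foldl_machineInterp_ctl M _ s hw hh

end Simulation

end PVMA

namespace PVMA

open Turing Turing.PartrecToTM2

/-! ### A universal machine -/

theorem primrec_natBits : Primrec Nat.bits := by
  refine Primrec.nat_strong_rec (α := Unit) (fun _ n => Nat.bits n)
    (g := fun _ l => if l.length = 0 then some [] else
      (l[l.length / 2]?).map fun r => Nat.bodd l.length :: r) ?_ (fun _ n => ?_) |>.comp
    (Primrec.const ()) Primrec.id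
  · have hlen : Primrec fun p : Unit × List (List Bool) => p.2.length :=
      Primrec.list_length.comp Primrec.snd
    refine Primrec.ite (Primrec.eq.comp hlen (Primrec.const 0)) (Primrec.const _) ?_
    refine Primrec.option_map (Primrec.list_getElem?.comp Primrec.snd
      (Primrec.nat_div.comp hlen (Primrec.const 2))) ?_
    exact Primrec.list_cons.comp (Primrec.nat_bodd.comp (hlen.comp Primrec.fst)) Primrec.snd
  · rcases Nat.eq_zero_or_pos n with rfl | hn
    · simp
    · have h2 : n / 2 < n := by omega
      rw [if_neg (by simp; omega)]
      simp only [List.length_map, List.length_range, List.getElem?_map,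
        List.getElem?_range h2, Option.map_some]
      obtain ⟨m, rfl | rfl⟩ := Nat.even_or_odd' n
      · rw [Nat.bit0_bits m (by omega), Nat.mul_div_cancel_left m two_pos]
        simp
      · rw [Nat.bit1_bits, show (2 * m + 1) / 2 = m by omega]
        simp

theorem trNat_eq_map_bits (n : ℕ) :
    trNat n = (Nat.bits n).map fun b => cond b Γ'.bit1 Γ'.bit0 := by
  have h : ∀ p : PosNum, trPosNum p = (Nat.bits p).map fun b => cond b Γ'.bit1 Γ'.bit0 := by
    intro p
    induction p with
    | one => simp [trPosNum]
    | bit0 p ih =>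
      rw [trPosNum, ih, PosNum.cast_bit0, ← two_mul, Nat.bit0_bits _ (PosNum.cast_pos p).ne']
      rfl
    | bit1 p ih =>
      rw [trPosNum, ih, PosNum.cast_bit1, ← two_mul, Nat.bit1_bits]
      rfl
  have h' : ∀ m : Num, trNum m = (Nat.bits m).map fun b => cond b Γ'.bit1 Γ'.bit0 := by
    rintro (_ | p)
    · simp [trNum]
    · exact h p
  rw [trNat, h', Num.to_of_nat]

theorem exists_list_machineLetters {K Γ Λ σ : Type} [Finite K] [Finite Γ] [Finite σ]
    (M : Λ → TM2.Stmt (fun _ : K => Γ) Λ σ) (S : Finset Λ) :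
    ∃ gs : List (MachineLetter K Γ Λ σ),
      ∀ x ∈ machineLetters {q | some q ∈ TM2.stmts M S}, x ∈ gs := by
  have hP : {q | some q ∈ TM2.stmts M S}.Finite :=
    (TM2.stmts M S).finite_toSet.preimage (Option.some_injective _).injOn
  have hfin : (Set.range MachineLetter.sym ∪ {MachineLetter.acc} ∪
      Set.image2 MachineLetter.ctl {q | some q ∈ TM2.stmts M S} (Set.univ : Set σ)).Finite :=
    ((Set.finite_range _).union (Set.finite_singleton _)).union (hP.image2 _ Set.finite_univ)
  refine ⟨hfin.toFinset.toList, fun x hx => ?_⟩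
  rw [Finset.mem_toList, Set.Finite.mem_toFinset]
  cases x with
  | sym p => exact Or.inl (Or.inl ⟨p, rfl⟩)
  | acc => exact Or.inl (Or.inr rfl)
  | ctl q s => exact Or.inr ⟨q, hx q s rfl, s, trivial, rfl⟩

theorem not_computablePred_eval_ofNat :
    ¬ ComputablePred fun x : ℕ => (Nat.Partrec.Code.eval (Denumerable.ofNat _ x) 0).Dom := by
  intro h
  obtain ⟨g, hg, hgp⟩ := ComputablePred.computable_iff.1 h
  refine ComputablePred.halting_problem 0 (ComputablePred.computable_iff.2
    ⟨fun c => g (Encodable.encode c), hg.comp Computable.encode, funext fun c => ?_⟩)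
  have := congrFun hgp (Encodable.encode c)
  simpa using this

theorem exists_universal_code : ∃ c : ToPartrec.Code, ∀ x : ℕ,
    c.eval [x] = pure <$> Nat.Partrec.Code.eval (Denumerable.ofNat _ x) 0 := by
  have h : Partrec fun x : ℕ => Nat.Partrec.Code.eval (Denumerable.ofNat _ x) 0 :=
    Nat.Partrec.Code.eval_part.comp (Computable.ofNat _) (Computable.const 0)
  obtain ⟨c, hc⟩ := ToPartrec.Code.exists_code (Nat.Partrec'.of_part
    (Partrec.comp (α := List.Vector ℕ 1) h Computable.vector_head))
  exact ⟨c, fun x => hc (x ::ᵥ List.Vector.nil)⟩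

theorem haltsFrom_trNormal_iff (c : ToPartrec.Code) (v : List ℕ) :
    HaltsFrom tr (tr (trNormal c Cont'.halt)) none (K'.elim (trList v) [] [] []) ↔
      (c.eval v).Dom := by
  have h : TM2.step tr (init c v) =
      some (TM2.stepAux (tr (trNormal c Cont'.halt)) none (K'.elim (trList v) [] [] [])) := rfl
  change (StateTransition.eval (TM2.step tr) (TM2.stepAux (tr (trNormal c Cont'.halt)) none
    (K'.elim (trList v) [] [] []))).Dom ↔ _
  have e := StateTransition.reaches_eval (Relation.ReflTransGen.single (Option.mem_def.2 h))
  exact iff_of_eq (congrArg Part.Dom (e.symm.trans (tr_eval c v)))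

/-- The initial stacks of the universal machine, as a word. -/
def inputWord (x : ℕ) : List (K' × Option Γ') :=
  [(K'.rev, none), (K'.aux, none), (K'.stack, none)] ++
    ((Nat.bits x).map fun b => (K'.main, some (cond b Γ'.bit1 Γ'.bit0))) ++
    [(K'.main, some Γ'.cons), (K'.main, none)]

theorem repStacks_inputWord (x : ℕ) :
    RepStacks (inputWord x) (K'.elim (trList [x]) [] [] []) := by
  intro k
  cases k <;> simp [inputWord, trList, trNat_eq_map_bits, List.filter_map,
    Function.comp_def]

theorem primrec_map_inputWord (g : K' × Option Γ' → ℕ) : Primrec fun x => (inputWord x).map g := by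
  have h : ∀ x, (inputWord x).map g =
      [g (K'.rev, none), g (K'.aux, none), g (K'.stack, none)] ++
        ((Nat.bits x).map fun b => cond b (g (K'.main, some Γ'.bit1)) (g (K'.main, some Γ'.bit0))) ++
        [g (K'.main, some Γ'.cons), g (K'.main, none)] := by
    intro x
    simp only [inputWord, List.map_append, List.map_map, List.map_cons, List.map_nil]
    congr 2
    exact List.map_congr_left fun b _ => by cases b <;> rfl
  refine Primrec.of_eq ?_ fun x => (h x).symm
  refine Primrec.list_append.comp (Primrec.list_append.comp (Primrec.const _)
    (Primrec.list_map primrec_natBits ?_)) (Primrec.const _)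
  exact Primrec.cond Primrec.snd (Primrec.const _) (Primrec.const _)

theorem primrec_chainCalls (N q : ℕ) {w : ℕ → List ℕ} (hw : Primrec w) :
    Primrec₂ fun x j => chainCalls N q (w x) j := by
  have hj : Primrec fun p : ℕ × ℕ => p.2 := Primrec.snd
  refine Primrec.ite (Primrec.nat_lt.comp hj (Primrec.const _))
    (Primrec.pair (Primrec.nat_div.comp hj (Primrec.const _))
      (Primrec.nat_mod.comp hj (Primrec.const _)))
    (Primrec.pair (Primrec.ite (Primrec.eq.comp hj (Primrec.const _)) (Primrec.const _)
      (Primrec.nat_sub.comp (Primrec.nat_add.comp (Primrec.const _) hj) (Primrec.const _)))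
      ((Primrec.list_getD 0).comp (hw.comp Primrec.fst)
        (Primrec.nat_sub.comp hj (Primrec.const _))))

theorem nonempty_hardFamily : ∃ N, Nonempty (HardFamily N) := by
  obtain ⟨c, hc⟩ := exists_universal_code
  have : Finite K' := Finite.of_surjective
    (fun i : Fin 4 => ![K'.main, K'.rev, K'.aux, K'.stack] i)
    (by rintro (_ | _ | _ | _); exacts [⟨0, rfl⟩, ⟨1, rfl⟩, ⟨2, rfl⟩, ⟨3, rfl⟩])
  obtain ⟨gs, hgs⟩ := exists_list_machineLetters tr (codeSupp c Cont'.halt)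
  have hN : 0 < gs.length := List.length_pos_of_mem (hgs _ acc_mem_machineLetters)
  have hl : trNormal c Cont'.halt ∈ codeSupp c Cont'.halt :=
    codeSupp_self _ _ (trStmts₁_self _)
  have hlen : Primrec fun x => (inputWord x).length :=
    (Primrec.list_length.comp (primrec_map_inputWord fun _ => 0)).of_eq fun x => by simp
  have hsym : ∀ p, (.sym p : MachineLetter K' Γ' Λ' (Option Γ')) ∈ gs := fun p =>
    hgs _ (sym_mem_machineLetters p)
  have hctl := hgs _ (ctl_mem_machineLetters (some_mem_stmts (M := tr) hl) none)
  refine ⟨gs.length, ⟨{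
    hN := hN
    k := fun x => gs.length + gs.length * gs.length + (inputWord x).length
    n := fun x => gs.length * gs.length + (inputWord x).length
    c := fun x => chainCalls gs.length (letterIdx gs (.ctl (tr (trNormal c Cont'.halt)) none))
      ((inputWord x).map fun p => letterIdx gs (.sym p))
    es := tableEqs tr gs
    d := fun x => (gs.length + gs.length * gs.length + (inputWord x).length - 1, letterIdx gs .acc)
    hk := Primrec.nat_add.comp (Primrec.const _) hlen
    hn := Primrec.nat_add.comp (Primrec.const _) hlen
    hc := primrec_chainCalls _ _ (primrec_map_inputWord _)
    hd := Primrec.pair (Primrec.nat_sub.comp (Primrec.nat_add.comp (Primrec.const _) hlen)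
      (Primrec.const 1)) (Primrec.const _)
    c_lt := fun x j _ => chainCalls_lt hN (letterIdx_lt hctl) (fun a ha => by
      obtain ⟨p, -, rfl⟩ := List.mem_map.1 ha
      exact letterIdx_lt (hsym p)) j
    n_le := fun x => by omega
    hard := fun h => not_computablePred_eval_ofNat (h.not.of_eq fun x => ?_) }⟩⟩
  rw [feasibleModulo_iff_not_haltsFrom hgs hN (tr_supports c Cont'.halt).2 hl none
    (repStacks_inputWord x) (by simp [inputWord]) (by omega), not_not, haltsFrom_trNormal_iff, hc]
  rfl

end PVMA

namespace PVMA

open FirstOrder FirstOrder.Language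

/-- Feasibility of a single coherent execution modulo associativity of a
binary function symbol is undecidable, and consequently the verification problem for
coherent programs modulo associativity axioms is undecidable. -/
theorem feasibility_and_verification_modulo_associativity_undecidable :
    (¬ ∃ g : ℕ → Bool, Computable g ∧
        ∀ (S : FinSig) (f : (S.lang).Functions 2) (m : ℕ)
          (init : Fin m → (S.lang).Constants) (ρ : Exec S.lang (Fin m)),
          Coherent ({phiAssoc f} : (S.lang).Theory) init ρ →
          (g (encL [S.enc, f.val, m, encInit S.encF init, encExec S.encF S.encR ρ]) = true ↔
            FeasibleModulo ({phiAssoc f} : (S.lang).Theory) init ρ)) ∧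
    (¬ ∃ g : ℕ → Bool, Computable g ∧
        ∀ (S : FinSig) (f : (S.lang).Functions 2) (m : ℕ)
          (init : Fin m → (S.lang).Constants) (s : Prog S.lang (Fin m))
          (φ : Post S.lang (Fin m)),
          CoherentProg ({phiAssoc f} : (S.lang).Theory) init s →
          (g (encL [S.enc, f.val, encVerifInput S.encF S.encR init s φ]) = true ↔
            Satisfies ({phiAssoc f} : (S.lang).Theory) init s φ)) := by
  obtain ⟨N, ⟨H⟩⟩ := nonempty_hardFamily
  exact ⟨H.not_decidable_feasible, H.not_decidable_satisfies⟩

end PVMA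
end
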